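/- arXiv:2206.13877 — 2 statements merged into one kernel-verified Lean document; each statement's English description precedes it below -/
import Mathlib

section
/- For n ≥ 2, the number of reverse alternating involutions of length 2n−1 avoiding the pattern 4321 equals M_n − M_{n−2}, where M_k denotes the k-th Motzkin number. -/
/-- A permutation is an involution if it equals its inverse. -/
def IsInvolution {n : ℕ} (π : Equiv.Perm (Fin n)) : Prop :=
  ∀ i, π (π i) = i

/-- `π` is alternating: `π i < π (i+1)` iff `i` is odd (1-based positions). -/
def IsAlternating {n : ℕ} (π : Equiv.Perm (Fin n)) : Prop :=
  ∀ (i : Fin n) (h : (i : ℕ) + 1 < n), (π i < π ⟨(i : ℕ) + 1, h⟩ ↔ Odd ((i : ℕ) + 1))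

/-- `π` is reverse alternating: `π i > π (i+1)` iff `i` is odd (1-based positions). -/
def IsRevAlternating {n : ℕ} (π : Equiv.Perm (Fin n)) : Prop :=
  ∀ (i : Fin n) (h : (i : ℕ) + 1 < n), (π ⟨(i : ℕ) + 1, h⟩ < π i ↔ Odd ((i : ℕ) + 1))

/-- `σ` contains the pattern `τ`. -/
def Contains {n k : ℕ} (σ : Equiv.Perm (Fin n)) (τ : Equiv.Perm (Fin k)) : Prop :=
  ∃ f : Fin k → Fin n, StrictMono f ∧ ∀ a b : Fin k, σ (f a) < σ (f b) ↔ τ a < τ b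

/-- `σ` avoids the pattern `τ`. -/
def Avoids {n k : ℕ} (σ : Equiv.Perm (Fin n)) (τ : Equiv.Perm (Fin k)) : Prop :=
  ¬ Contains σ τ
def p123 : Equiv.Perm (Fin 3) := ⟨![0,1,2], ![0,1,2], by decide, by decide⟩
def p132 : Equiv.Perm (Fin 3) := ⟨![0,2,1], ![0,2,1], by decide, by decide⟩
def p321 : Equiv.Perm (Fin 3) := ⟨![2,1,0], ![2,1,0], by decide, by decide⟩
def p1234 : Equiv.Perm (Fin 4) := ⟨![0,1,2,3], ![0,1,2,3], by decide, by decide⟩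
def p4321 : Equiv.Perm (Fin 4) := ⟨![3,2,1,0], ![3,2,1,0], by decide, by decide⟩
def p3412 : Equiv.Perm (Fin 4) := ⟨![2,3,0,1], ![2,3,0,1], by decide, by decide⟩
def p3421 : Equiv.Perm (Fin 4) := ⟨![2,3,1,0], ![3,2,0,1], by decide, by decide⟩
def p4312 : Equiv.Perm (Fin 4) := ⟨![3,2,0,1], ![2,3,1,0], by decide, by decide⟩
def p2431 : Equiv.Perm (Fin 4) := ⟨![1,3,2,0], ![3,0,2,1], by decide, by decide⟩
def p4132 : Equiv.Perm (Fin 4) := ⟨![3,0,2,1], ![1,3,2,0], by decide, by decide⟩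


open PowerSeries in
/-- Motzkin paths from height `h` to height `0`. -/
def motzN : ℕ → ℕ → ℕ
  | 0, 0 => 1
  | 0, _ + 1 => 0
  | m + 1, 0 => motzN m 0 + motzN m 1
  | m + 1, h + 1 => motzN m h + motzN m (h + 1) + motzN m (h + 2)

open PowerSeries in
theorem motzN_eq (M : ℕ → ℕ) (hM0 : M 0 = 1)
    (hMrec : ∀ n, M (n + 1) = M n + ∑ k ∈ Finset.range n, M k * M (n - 1 - k)) (m : ℕ) :
    motzN m 0 = M m := by
  set F : PowerSeries ℤ := PowerSeries.mk (fun k => (M k : ℤ)) with hF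
  have key : F = 1 + X * F + X * (X * (F * F)) := by
    ext k
    rcases k with _ | k
    · simp [hF, hM0]
    · rw [map_add, map_add, coeff_succ_X_mul, coeff_succ_X_mul]
      rcases k with _ | k
      · simp [hF, hMrec, coeff_one]
      · rw [coeff_succ_X_mul, coeff_mul, Finset.Nat.sum_antidiagonal_eq_sum_range_succ_mk]
        simp [hF, coeff_one, hMrec (k + 1)]
  have main : ∀ m h, (motzN m h : ℤ) = coeff m (F * (X * F) ^ h) := by
    intro m
    induction m with
    | zero =>
      intro h
      rcases h with _ | h
      · simp [motzN, hF, hM0]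
      · simp [motzN]
    | succ m ih =>
      intro h
      rcases h with _ | h
      · have e : F * (X * F) ^ 0 = 1 + X * (F * (X * F) ^ 0 + F * (X * F) ^ 1) := by
          linear_combination key
        rw [e, map_add, coeff_succ_X_mul, map_add, ← ih, ← ih]
        simp [motzN, coeff_one]
      · have e : F * (X * F) ^ (h + 1) =
            X * (F * (X * F) ^ h + F * (X * F) ^ (h + 1) + F * (X * F) ^ (h + 2)) := by
          linear_combination (F * (X * F) ^ h * X) * key
        rw [e, coeff_succ_X_mul, map_add, map_add, ← ih, ← ih, ← ih]
        simp [motzN]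
  have := main m 0
  simp [hF] at this
  exact_mod_cast this

/-- Valid words. -/
def ValidW {m : ℕ} (h : ℤ) (w : Fin m → SignType) : Prop :=
  (∀ k : ℕ, 0 ≤ h + ∑ j : Fin m, if j.val < k then (w j : ℤ) else 0) ∧
  (h + ∑ j : Fin m, (w j : ℤ) = 0) ∧
  (∀ i j : Fin m, j.val = i.val + 1 → (w j < w i ↔ Even i.val))

theorem validW_cons2 {m : ℕ} (h : ℤ) (a b : SignType) (w : Fin (m + 2) → SignType) :
    ValidW h (Fin.cons a (Fin.cons b w : Fin (m + 3) → SignType) : Fin (m + 4) → SignType) ↔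
      0 ≤ h ∧ 0 ≤ h + a ∧ b < a ∧ ValidW (h + a + b) w := by
  constructor
  · rintro ⟨h1, h2, h3⟩
    refine ⟨by simpa using h1 0, by simpa [Fin.sum_univ_succ (n := m + 3)] using h1 1, ?_, ?_, ?_, ?_⟩
    · simpa using h3 0 1 (by simp)
    · intro k
      have := h1 (k + 2)
      rw [Fin.sum_univ_succ, Fin.sum_univ_succ] at this
      simpa [add_assoc] using this
    · rw [Fin.sum_univ_succ, Fin.sum_univ_succ] at h2
      simpa [add_assoc] using h2
    · intro i j hij
      have := h3 i.succ.succ j.succ.succ (by simp [hij])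
      simpa [Nat.even_add_one] using this
  · rintro ⟨h0, ha, hba, h1, h2, h3⟩
    refine ⟨?_, ?_, ?_⟩
    · intro k
      rcases k with _ | _ | k
      · simpa using h0
      · simpa [Fin.sum_univ_succ (n := m + 3)] using ha
      · have := h1 k
        rw [Fin.sum_univ_succ, Fin.sum_univ_succ]
        simpa [add_assoc] using this
    · rw [Fin.sum_univ_succ, Fin.sum_univ_succ]
      simpa [add_assoc] using h2
    · intro i j hij
      have hw : ¬ w 0 < b := by
        have h01 := (h3 0 1 (by simp)).2 (by simp)
        generalize w 0 = x at *
        generalize w 1 = y at *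
        clear h1 h2 h3 ha
        revert h01 hba
        revert a b x y
        decide
      induction i using Fin.cases with
      | zero =>
        have : j = Fin.succ 0 := Fin.ext (by simpa using hij)
        subst this
        simpa using hba
      | succ i =>
        induction i using Fin.cases with
        | zero =>
          have : j = Fin.succ (Fin.succ 0) := Fin.ext hij
          subst this
          have e : (Fin.cons a (Fin.cons b w : Fin (m + 3) → SignType) : Fin (m + 4) → SignType)
            (Fin.succ (Fin.succ 0)) = w 0 := rfl
          rw [e]
          simpa using hw
        | succ i =>
          induction j using Fin.cases with
          | zero => simp at hij
          | succ j =>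
            induction j using Fin.cases with
            | zero => simp at hij
            | succ j =>
              have := h3 i j (by simpa using hij)
              simpa [Nat.even_add_one] using this

open Classical in
/-- Number of valid words. -/
noncomputable def cntW (m : ℕ) (h : ℤ) : ℕ := ∑ w : Fin m → SignType, if ValidW h w then 1 else 0

theorem sum_signType (f : SignType → ℕ) : ∑ a, f a = f 0 + f (-1) + f 1 := by
  have : (Finset.univ : Finset SignType) = {0, -1, 1} := by decide
  rw [this]
  simp [add_assoc]

theorem sum_cons (m : ℕ) (f : (Fin (m + 1) → SignType) → ℕ) :
    ∑ w, f w = ∑ a : SignType, ∑ w : Fin m → SignType, f (Fin.cons a w) := by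
  rw [← Fintype.sum_prod_type']
  exact (Fintype.sum_equiv (Fin.consEquiv (fun _ => SignType)) _ _ (fun p => rfl)).symm

theorem cntW_neg (m : ℕ) (h : ℤ) (hh : h < 0) : cntW m h = 0 := by
  classical
  unfold cntW
  refine Finset.sum_eq_zero fun w _ => if_neg fun hv => ?_
  have := hv.1 0
  simp at this
  omega

theorem cntW_step (m : ℕ) (h : ℤ) (hh : 0 ≤ h) :
    cntW (m + 4) h = cntW (m + 2) (h - 1) + cntW (m + 2) h + cntW (m + 2) (h + 1) := by
  classical
  unfold cntW
  rw [sum_cons]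
  simp_rw [sum_cons (m + 2), validW_cons2]
  simp only [sum_signType]
  have d1 : ¬ ((0 : SignType) < 0) := by decide
  have d2 : ((-1 : SignType) < 0) := by decide
  have d3 : ¬ ((1 : SignType) < 0) := by decide
  have d4 : ¬ ((0 : SignType) < -1) := by decide
  have d5 : ¬ ((-1 : SignType) < -1) := by decide
  have d6 : ¬ ((1 : SignType) < -1) := by decide
  have d7 : ((0 : SignType) < 1) := by decide
  have d8 : ((-1 : SignType) < 1) := by decide
  have d9 : ¬ ((1 : SignType) < 1) := by decide
  have hh' : 0 ≤ h + 1 := by omega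
  simp [d2, d3, d4, d6, d7, d8, hh, hh', ← sub_eq_add_neg]
  omega

theorem validW_three (h : ℤ) (a b c : SignType) :
    ValidW h ![a, b, c] ↔ (0 ≤ h ∧ 0 ≤ h + a ∧ 0 ≤ h + a + b ∧ h + a + b + c = 0 ∧ b < a ∧ ¬ c < b) := by
  constructor
  · rintro ⟨h1, h2, h3⟩
    have e0 := h1 0
    have e1 := h1 1
    have e2 := h1 2
    have f0 := h3 0 1 (by simp)
    have f1 := h3 1 2 (by simp)
    simp [Fin.sum_univ_succ] at e0 e1 e2 f0 f1 h2
    refine ⟨e0, e1, by linarith, by linarith, f0, not_lt.2 f1⟩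
  · rintro ⟨h0, h1, h2, h3, h4, h5⟩
    refine ⟨?_, by simp [Fin.sum_univ_succ]; linarith, ?_⟩
    · intro k
      rcases k with _ | _ | _ | k
      · simpa using h0
      · simpa [Fin.sum_univ_succ] using h1
      · simp [Fin.sum_univ_succ]; linarith
      · simp [Fin.sum_univ_succ]; linarith
    · intro i j hij
      fin_cases i <;> fin_cases j <;> simp_all

theorem cntW_three (h : ℤ) :
    cntW 3 h = if h = 0 then 1 else if h = 1 then 2 else if h = 2 then 1 else 0 := by
  classical
  unfold cntW
  have key : ∀ a b c : SignType, ∀ w : Fin 0 → SignType,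
      (Fin.cons a (Fin.cons b (Fin.cons c w : Fin 1 → SignType) : Fin 2 → SignType) :
        Fin 3 → SignType) = ![a, b, c] := by
    intro a b c w
    funext i
    fin_cases i <;> rfl
  rw [sum_cons]
  simp_rw [sum_cons 1, sum_cons 0, key, validW_three]
  by_cases h3 : h ≠ 0 ∧ h ≠ 1 ∧ h ≠ 2
  · rw [if_neg h3.1, if_neg h3.2.1, if_neg h3.2.2]
    refine Finset.sum_eq_zero fun a _ => Finset.sum_eq_zero fun b _ =>
      Finset.sum_eq_zero fun c _ => Finset.sum_eq_zero fun w _ => if_neg ?_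
    rintro ⟨g1, g2, g3, g4, g5, g6⟩
    rcases a with _ | _ | _ <;> rcases b with _ | _ | _ <;> rcases c with _ | _ | _ <;>
      first
        | exact absurd g5 (by decide)
        | exact g6 (by decide)
        | (simp at g4; omega)
  simp only [sum_signType]
  have d1 : ¬ ((0 : SignType) < 0) := by decide
  have d2 : ((-1 : SignType) < 0) := by decide
  have d3 : ¬ ((1 : SignType) < 0) := by decide
  have d4 : ¬ ((0 : SignType) < -1) := by decide
  have d5 : ¬ ((-1 : SignType) < -1) := by decide
  have d6 : ¬ ((1 : SignType) < -1) := by decide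
  have d7 : ((0 : SignType) < 1) := by decide
  have d8 : ((-1 : SignType) < 1) := by decide
  have d9 : ¬ ((1 : SignType) < 1) := by decide
  have h4 : h = 0 ∨ h = 1 ∨ h = 2 := by omega
  rcases h4 with rfl | rfl | rfl <;> norm_num [d2, d3, d4, d6, d7, d8]

theorem cntW_eq (k h : ℕ) : cntW (2 * k + 3) h + motzN k h = motzN (k + 2) h := by
  induction k generalizing h with
  | zero =>
    rw [cntW_three]
    rcases h with _ | _ | _ | h <;> simp [motzN]
    split_ifs <;> omega
  | succ k ih =>
    have e : 2 * (k + 1) + 3 = (2 * k + 1) + 4 := by ring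
    rw [e, cntW_step _ _ (by omega)]
    rcases h with _ | h
    · have a := ih 0
      have b := ih 1
      rw [cntW_neg _ _ (by simp)]
      have e3 : 2 * k + 1 + 2 = 2 * k + 3 := by ring
      have m1 : motzN (k + 1) 0 = motzN k 0 + motzN k 1 := rfl
      have m2 : motzN (k + 1 + 2) 0 = motzN (k + 2) 0 + motzN (k + 2) 1 := rfl
      rw [e3, m1, m2]
      push_cast at *
      simp only [zero_add] at *
      omega
    · have a := ih h
      have b := ih (h + 1)
      have c := ih (h + 2)
      have e1 : ((h + 1 : ℕ) : ℤ) - 1 = h := by push_cast; ring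
      have e2 : ((h + 1 : ℕ) : ℤ) + 1 = (h + 2 : ℕ) := by push_cast; ring
      rw [e1, e2]
      have e3 : 2 * k + 1 + 2 = 2 * k + 3 := by ring
      have m1 : motzN (k + 1) (h + 1) = motzN k h + motzN k (h + 1) + motzN k (h + 2) := rfl
      have m2 : motzN (k + 1 + 2) (h + 1) =
        motzN (k + 2) h + motzN (k + 2) (h + 1) + motzN (k + 2) (h + 2) := rfl
      rw [e3, m1, m2]
      omega

/-- No two nested 2-cycles. -/
def NonNest {m : ℕ} (π : Equiv.Perm (Fin m)) : Prop :=
  ∀ a b, a < b → b < π b → π b < π a → False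

/-- The sign word of a permutation. -/
def wordOf {m : ℕ} (π : Equiv.Perm (Fin m)) (i : Fin m) : SignType :=
  if i < π i then 1 else if π i < i then -1 else 0

theorem wordOf_one {m : ℕ} (π : Equiv.Perm (Fin m)) (i : Fin m) :
    wordOf π i = 1 ↔ i < π i := by
  unfold wordOf
  split_ifs <;> simp_all

theorem wordOf_neg {m : ℕ} (π : Equiv.Perm (Fin m)) (i : Fin m) :
    wordOf π i = -1 ↔ π i < i := by
  unfold wordOf
  split_ifs with h1 h2
  · simp [h1.le]
  · simp [h2]
  · simp [h2]

theorem wordOf_zero {m : ℕ} (π : Equiv.Perm (Fin m)) (i : Fin m) :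
    wordOf π i = 0 ↔ π i = i := by
  unfold wordOf
  split_ifs with h1 h2
  · simp [h1.ne']
  · simp [h2.ne]
  · simp [le_antisymm (not_lt.1 h1) (not_lt.1 h2)]

theorem sign_cases (s : SignType) : s = 0 ∨ s = -1 ∨ s = 1 := by
  revert s; decide

theorem nonNest_of_avoids {m : ℕ} (π : Equiv.Perm (Fin m)) (hi : IsInvolution π)
    (ha : Avoids π p4321) : NonNest π := by
  intro a b hab hb hba
  apply ha
  refine ⟨![a, b, π b, π a], ?_, ?_⟩
  · rw [Fin.strictMono_iff_lt_succ]
    intro i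
    fin_cases i
    · exact hab
    · exact hb
    · exact hba
  · have hia := hi a
    have hib := hi b
    intro x y
    fin_cases x <;> fin_cases y <;> simp [p4321, hia, hib] <;> first | omega | decide

theorem mono_of_word {m : ℕ} (π : Equiv.Perm (Fin m)) (hi : IsInvolution π) (hn : NonNest π)
    (x y : Fin m) (hxy : x < y) (hw : wordOf π x = wordOf π y) : π x < π y := by
  by_contra hc
  have hne : π x ≠ π y := fun h => hxy.ne (π.injective h)
  have hc : π y < π x := lt_of_le_of_ne (not_lt.1 hc) hne.symm
  rcases sign_cases (wordOf π x) with h | h | h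
  · have h' := h
    rw [hw] at h'
    rw [wordOf_zero] at h h'
    rw [h, h'] at hc
    exact absurd hxy hc.asymm
  · have h' := h
    rw [hw] at h'
    rw [wordOf_neg] at h h'
    refine hn (π y) (π x) hc ?_ ?_
    · rwa [hi]
    · rwa [hi, hi]
  · have h' := h
    rw [hw] at h'
    rw [wordOf_one] at h h'
    exact hn x y hxy h' hc

theorem avoids_of_nonNest {m : ℕ} (π : Equiv.Perm (Fin m)) (hi : IsInvolution π)
    (hn : NonNest π) : Avoids π p4321 := by
  rintro ⟨f, hf, hp⟩
  obtain ⟨a, b, hab, he⟩ := Fintype.exists_ne_map_eq_of_card_lt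
    (fun a : Fin 4 => wordOf π (f a)) (by decide)
  wlog h : a < b generalizing a b
  · exact this b a hab.symm he.symm (lt_of_le_of_ne (not_lt.1 h) hab.symm)
  have h1 := mono_of_word π hi hn _ _ (hf h) he
  rw [hp] at h1
  revert h h1
  clear he hab
  revert a b
  decide

theorem desc_iff {m : ℕ} (π : Equiv.Perm (Fin m)) (hi : IsInvolution π) (hn : NonNest π)
    (i j : Fin m) (hij : j.val = i.val + 1) :
    π j < π i ↔ wordOf π j < wordOf π i := by
  have hlt : i < j := by rw [Fin.lt_def]; omega
  have hne : (π i).val ≠ (π j).val := fun h => hlt.ne (π.injective (Fin.ext h))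
  have d1 : ¬ ((0 : SignType) < 0) := by decide
  have d2 : ((-1 : SignType) < 0) := by decide
  have d3 : ¬ ((1 : SignType) < 0) := by decide
  have d4 : ¬ ((0 : SignType) < -1) := by decide
  have d5 : ¬ ((-1 : SignType) < -1) := by decide
  have d6 : ¬ ((1 : SignType) < -1) := by decide
  have d7 : ((0 : SignType) < 1) := by decide
  have d8 : ((-1 : SignType) < 1) := by decide
  have d9 : ¬ ((1 : SignType) < 1) := by decide
  by_cases he : wordOf π i = wordOf π j
  · have := mono_of_word π hi hn i j hlt he
    rw [he]
    simp [this.le]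
  · rcases sign_cases (wordOf π i) with h | h | h <;>
    rcases sign_cases (wordOf π j) with h' | h' | h' <;>
    first
      | exact absurd (h.trans h'.symm) he
      | (rw [h, h']
         simp only [wordOf_zero, wordOf_one, wordOf_neg, Fin.lt_def, Fin.ext_iff] at h h'
         simp only [d1, d2, d3, d4, d5, d6, d7, d8, d9, Fin.lt_def, iff_true, iff_false]
         omega)

theorem sum_word {m : ℕ} (w : Fin m → SignType) (k : ℕ) :
    (∑ j : Fin m, if j.val < k then (w j : ℤ) else 0) =
      ((Finset.univ.filter fun j : Fin m => w j = 1 ∧ j.val < k).card : ℤ) -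
      ((Finset.univ.filter fun j : Fin m => w j = -1 ∧ j.val < k).card : ℤ) := by
  rw [Finset.card_filter, Finset.card_filter]
  push_cast
  rw [← Finset.sum_sub_distrib]
  refine Finset.sum_congr rfl fun j _ => ?_
  have e : ¬ ((-1 : SignType) = 1) := by decide
  have e' : ¬ ((1 : SignType) = -1) := by decide
  rcases sign_cases (w j) with h | h | h <;> by_cases hk : j.val < k <;> simp [h, hk, e, e']

theorem sum_word_all {m : ℕ} (w : Fin m → SignType) :
    (∑ j : Fin m, (w j : ℤ)) =
      ((Finset.univ.filter fun j : Fin m => w j = 1).card : ℤ) -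
      ((Finset.univ.filter fun j : Fin m => w j = -1).card : ℤ) := by
  have := sum_word w m
  simpa using this

theorem validW_wordOf {m : ℕ} (π : Equiv.Perm (Fin m)) (hi : IsInvolution π)
    (hr : IsRevAlternating π) (hn : NonNest π) : ValidW 0 (wordOf π) := by
  refine ⟨?_, ?_, ?_⟩
  · intro k
    rw [sum_word, zero_add, sub_nonneg, Nat.cast_le]
    refine Finset.card_le_card_of_injOn π ?_ π.injective.injOn
    intro x hx
    simp only [wordOf_neg, Finset.coe_filter, Finset.mem_univ, true_and, Set.mem_setOf_eq] at hx
    simp only [wordOf_one, Finset.coe_filter, Finset.mem_univ, true_and, Set.mem_setOf_eq, hi x]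
    refine ⟨hx.1, ?_⟩
    have := hx.1
    rw [Fin.lt_def] at this
    omega
  · rw [sum_word_all, zero_add, sub_eq_zero, Nat.cast_inj]
    refine Finset.card_bij (fun x _ => π x) ?_ (fun _ _ _ _ h => π.injective h) ?_
    · intro x hx
      simpa [wordOf_one, wordOf_neg, hi x] using hx
    · intro y hy
      refine ⟨π y, ?_, hi y⟩
      simpa [wordOf_one, wordOf_neg, hi y] using hy
  · intro i j hij
    rw [← desc_iff π hi hn i j hij]
    have := hr i (by omega)
    have ej : j = ⟨i.val + 1, by omega⟩ := Fin.ext hij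
    rw [ej, this, Nat.odd_add_one, Nat.not_odd_iff_even]

theorem wordOf_inj {m : ℕ} (π σ : Equiv.Perm (Fin m)) (hi : IsInvolution π) (hs : IsInvolution σ)
    (hn : NonNest π) (hn' : NonNest σ) (hw : wordOf π = wordOf σ) : π = σ := by
  have iso : ∀ τ : Equiv.Perm (Fin m), IsInvolution τ → NonNest τ → wordOf τ = wordOf σ →
      ∃ e : {x // wordOf σ x = 1} ≃o {x // wordOf σ x = -1}, ∀ x, (e x : Fin m) = τ x := by
    intro τ ht hnt hwt
    rw [← hwt]
    let e0 : {x // wordOf τ x = 1} ≃ {x // wordOf τ x = -1} :=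
      { toFun := fun x => ⟨τ x, by
          have := x.2
          rw [wordOf_one] at this
          rwa [wordOf_neg, ht]⟩
        invFun := fun x => ⟨τ x, by
          have := x.2
          rw [wordOf_neg] at this
          rwa [wordOf_one, ht]⟩
        left_inv := fun x => Subtype.ext (ht x)
        right_inv := fun x => Subtype.ext (ht x) }
    have hm : StrictMono e0 := by
      intro x y hxy
      exact mono_of_word τ ht hnt x y hxy (x.2.trans y.2.symm)
    exact ⟨hm.orderIsoOfSurjective e0 e0.surjective, fun x => rfl⟩
  obtain ⟨e, he⟩ := iso π hi hn hw
  obtain ⟨e', he'⟩ := iso σ hs hn' rfl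
  have hee : e = e' := Subsingleton.elim _ _
  subst hee
  have h1 : ∀ x, wordOf σ x = 1 → π x = σ x := fun x hx => by rw [← he ⟨x, hx⟩, he' ⟨x, hx⟩]
  ext x : 1
  rcases sign_cases (wordOf σ x) with h | h | h
  · have h' := h
    rw [← hw] at h'
    rw [wordOf_zero] at h h'
    rw [h, h']
  · rw [wordOf_neg] at h
    have h2 := h1 (σ x) (by rw [wordOf_one, hs]; exact h)
    rw [hs] at h2
    rw [← h2, hi, h2]
  · exact h1 x h

theorem wordOf_surj {m : ℕ} (w : Fin m → SignType) (hv : ValidW 0 w) :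
    ∃ π : Equiv.Perm (Fin m), IsInvolution π ∧ NonNest π ∧ wordOf π = w := by
  obtain ⟨hp, ht, -⟩ := hv
  rw [sum_word_all, zero_add, sub_eq_zero, Nat.cast_inj] at ht
  set U := Finset.univ.filter fun j : Fin m => w j = 1 with hU
  set D := Finset.univ.filter fun j : Fin m => w j = -1 with hD
  have mU : ∀ x, x ∈ U ↔ w x = 1 := by simp [hU]
  have mD : ∀ x, x ∈ D ↔ w x = -1 := by simp [hD]
  have hUD : ∀ x, x ∈ U → x ∈ D → False := by
    intro x h1 h2
    rw [mU] at h1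
    rw [mD, h1] at h2
    exact absurd h2 (by decide)
  let e : U ≃o D := (U.orderIsoOfFin rfl).symm.trans (D.orderIsoOfFin ht.symm)
  have elt : ∀ u : U, (u : Fin m) < e u := by
    intro u
    by_contra hc
    have hc : ((e u : D) : Fin m) < u := by
      refine lt_of_le_of_ne (not_lt.1 hc) fun h => hUD u u.2 ?_
      rw [← h]
      exact (e u).2
    have h1 := hp ((e u : D) : Fin m).val.succ
    rw [sum_word, zero_add, sub_nonneg, Nat.cast_le] at h1
    have h2 : (Finset.univ.filter fun j : Fin m => w j = 1 ∧ j ≤ u).card ≤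
        (Finset.univ.filter fun j : Fin m => w j = -1 ∧ j.val < ((e u : D) : Fin m).val.succ).card := by
      refine Finset.card_le_card_of_injOn (fun x => if hx : x ∈ U then (e ⟨x, hx⟩ : Fin m) else x) ?_ ?_
      · intro x hx
        simp only [Finset.coe_filter, Finset.mem_univ, true_and, Set.mem_setOf_eq] at hx
        have hxU := (mU x).2 hx.1
        simp only [Finset.coe_filter, Finset.mem_univ, true_and, Set.mem_setOf_eq, hxU, dif_pos]
        refine ⟨(mD _).1 (e _).2, Nat.lt_succ_of_le ?_⟩
        have : (⟨x, hxU⟩ : U) ≤ u := hx.2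
        exact e.monotone this
      · intro x hx y hy hxy
        simp only [Finset.coe_filter, Finset.mem_univ, true_and, Set.mem_setOf_eq] at hx hy
        have hxU := (mU x).2 hx.1
        have hyU := (mU y).2 hy.1
        simp only [hxU, hyU, dif_pos] at hxy
        have := e.injective (Subtype.ext hxy)
        exact congrArg Subtype.val this
    have h3 : (Finset.univ.filter fun j : Fin m => w j = 1 ∧ j.val < ((e u : D) : Fin m).val.succ).card <
        (Finset.univ.filter fun j : Fin m => w j = 1 ∧ j ≤ u).card := by
      refine Finset.card_lt_card (Finset.ssubset_iff_subset_ne.2 ⟨?_, ?_⟩)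
      · intro x hx
        simp only [Finset.mem_filter, Finset.mem_univ, true_and] at hx ⊢
        refine ⟨hx.1, ?_⟩
        rw [Fin.lt_def] at hc
        rw [Fin.le_def]
        omega
      · intro h
        have : (u : Fin m) ∈ Finset.univ.filter fun j : Fin m => w j = 1 ∧ j ≤ u := by
          simp [← mU, u.2]
        rw [← h] at this
        simp only [Finset.mem_filter, Finset.mem_univ, true_and] at this
        rw [Fin.lt_def] at hc
        omega
    omega
  let g : Fin m → Fin m := fun x =>
    if hx : x ∈ U then (e ⟨x, hx⟩ : Fin m) else if hx : x ∈ D then (e.symm ⟨x, hx⟩ : Fin m) else x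
  have gU : ∀ x (hx : x ∈ U), g x = e ⟨x, hx⟩ := fun x hx => dif_pos hx
  have gD : ∀ x (hx : x ∈ D), g x = e.symm ⟨x, hx⟩ := fun x hx => by
    simp only [g]
    rw [dif_neg (fun h => hUD x h hx), dif_pos hx]
  have g0 : ∀ x, x ∉ U → x ∉ D → g x = x := fun x h1 h2 => by
    simp only [g]
    rw [dif_neg h1, dif_neg h2]
  have ginv : Function.Involutive g := by
    intro x
    by_cases h1 : x ∈ U
    · rw [gU x h1, gD _ (e _).2]
      simp
    · by_cases h2 : x ∈ D
      · rw [gD x h2, gU _ (e.symm _).2]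
        simp
      · rw [g0 x h1 h2, g0 x h1 h2]
  have gDlt : ∀ x, x ∈ D → g x < x := by
    intro x hx
    have := elt (e.symm ⟨x, hx⟩)
    rw [gD x hx]
    simpa using this
  have gUlt : ∀ x, x ∈ U → x < g x := by
    intro x hx
    rw [gU x hx]
    exact elt ⟨x, hx⟩
  have hUof : ∀ x, x < g x → x ∈ U := by
    intro x hx
    by_contra h
    by_cases h2 : x ∈ D
    · exact absurd (gDlt x h2) hx.asymm
    · rw [g0 x h h2] at hx
      exact lt_irrefl _ hx
  refine ⟨ginv.toPerm, ginv, ?_, ?_⟩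
  · intro a b hab hb hba
    change b < g b at hb
    change g b < g a at hba
    have hbU := hUof b hb
    have haU := hUof a (hab.trans (hb.trans hba))
    rw [gU b hbU, gU a haU] at hba
    have : e ⟨b, hbU⟩ < e ⟨a, haU⟩ := hba
    rw [e.lt_iff_lt] at this
    exact absurd hab (lt_asymm this)
  · funext x
    rcases sign_cases (w x) with h | h | h
    · rw [h, wordOf_zero]
      refine g0 x ?_ ?_
      · rw [mU, h]; decide
      · rw [mD, h]; decide
    · rw [h, wordOf_neg]
      exact gDlt x ((mD x).2 h)
    · rw [h, wordOf_one]
      exact gUlt x ((mU x).2 h)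

theorem card_eq_cntW (m : ℕ) :
    Nat.card {π : Equiv.Perm (Fin m) //
      IsInvolution π ∧ IsRevAlternating π ∧ Avoids π p4321} = cntW m 0 := by
  classical
  have : cntW m 0 = Nat.card {w : Fin m → SignType // ValidW 0 w} := by
    rw [Nat.card_eq_fintype_card, Fintype.card_subtype, Finset.card_filter]
    rfl
  rw [this]
  refine Nat.card_eq_of_bijective (fun π => ⟨wordOf π.1, validW_wordOf π.1 π.2.1 π.2.2.1
    (nonNest_of_avoids π.1 π.2.1 π.2.2.2)⟩) ⟨?_, ?_⟩
  · intro π σ h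
    exact Subtype.ext (wordOf_inj π.1 σ.1 π.2.1 σ.2.1 (nonNest_of_avoids π.1 π.2.1 π.2.2.2)
      (nonNest_of_avoids σ.1 σ.2.1 σ.2.2.2) (congrArg Subtype.val h))
  · rintro ⟨w, hw⟩
    obtain ⟨π, hi, hn, rfl⟩ := wordOf_surj w hw
    refine ⟨⟨π, hi, ?_, avoids_of_nonNest π hi hn⟩, rfl⟩
    intro i h
    rw [desc_iff π hi hn i ⟨i.val + 1, h⟩ rfl, hw.2.2 i ⟨i.val + 1, h⟩ rfl, Nat.odd_add_one,
      Nat.not_odd_iff_even]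

/-- For n ≥ 2, the number of reverse alternating involutions of length 2n-1
avoiding 4321 is M_n - M_{n-2}. -/
theorem card_RAI_odd_avoiding_4321 (M : ℕ → ℕ) (hM0 : M 0 = 1)
    (hMrec : ∀ n, M (n + 1) = M n + ∑ k ∈ Finset.range n, M k * M (n - 1 - k))
    (n : ℕ) (hn : 2 ≤ n) :
    Nat.card {π : Equiv.Perm (Fin (2 * n - 1)) //
      IsInvolution π ∧ IsRevAlternating π ∧ Avoids π p4321} = M n - M (n - 2) := by
  obtain ⟨k, rfl⟩ : ∃ k, n = k + 2 := ⟨n - 2, by omega⟩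
  have e : 2 * (k + 2) - 1 = 2 * k + 3 := by omega
  rw [e, card_eq_cntW]
  have := cntW_eq k 0
  rw [motzN_eq M hM0 hMrec, motzN_eq M hM0 hMrec] at this
  simp only [Nat.cast_zero] at this
  have e2 : k + 2 - 2 = k := by omega
  rw [e2]
  omega
end

section
/- For every n, the number of alternating involutions of length n avoiding the pattern 1234 equals the number of reverse alternating involutions of length n avoiding the pattern 4321. -/
namespace RSG

open Classical in
/-- One row of the growth diagram: corner values computed from the boundary `b` and points `X`. -/
noncomputable def A (b : ℕ → ℕ) (X : ℕ → ℕ → Prop) : ℕ → ℕ → ℕ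
  | 0, j => b j
  | i + 1, 0 => b (i + 1)
  | i + 1, j + 1 =>
    if X i j then A b X i j + 1 else max (A b X i (j + 1)) (A b X (i + 1) j)

/-- Points passed on to the next row. -/
def nx (b : ℕ → ℕ) (X : ℕ → ℕ → Prop) (i j : ℕ) : Prop :=
  A b X (i + 1) j = A b X i j + 1 ∧ A b X i (j + 1) = A b X i j + 1

/-- Symmetric partial permutation compatible with the boundary. -/
structure PP (b : ℕ → ℕ) (X : ℕ → ℕ → Prop) : Prop where
  hb : ∀ i, b (i + 1) = b i ∨ b (i + 1) = b i + 1
  hs : ∀ i j, X i j → X j i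
  hc : ∀ i j k, X i j → X i k → j = k
  hbc : ∀ i j, b (i + 1) = b i + 1 → ¬ X i j

/-- The local rule, around one cell. -/
def Cell (x x' : Prop) (p q s t : ℕ) : Prop :=
  (x ∧ ¬ x' ∧ q = p ∧ s = p ∧ t = p + 1) ∨
  (¬ x ∧ x' ∧ q = p + 1 ∧ s = p + 1 ∧ t = p + 1) ∨
  (¬ x ∧ ¬ x' ∧ q = p ∧ s = p ∧ t = p) ∨
  (¬ x ∧ ¬ x' ∧ q = p + 1 ∧ s = p ∧ t = p + 1) ∨
  (¬ x ∧ ¬ x' ∧ q = p ∧ s = p + 1 ∧ t = p + 1)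

theorem A_zero_left (b X) (j : ℕ) : A b X 0 j = b j := by simp [A]
theorem A_zero_right (b X) (i : ℕ) : A b X i 0 = b i := by cases i <;> simp [A]

open Classical in
theorem A_succ (b X) (i j : ℕ) : A b X (i + 1) (j + 1) =
    if X i j then A b X i j + 1 else max (A b X i (j + 1)) (A b X (i + 1) j) := by
  rw [A]

variable {b : ℕ → ℕ} {X : ℕ → ℕ → Prop}

theorem A_symm (hs : ∀ i j, X i j → X j i) : ∀ i j, A b X i j = A b X j i := by
  intro i
  induction i with
  | zero => intro j; rw [A_zero_left, A_zero_right]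
  | succ i ih =>
    intro j
    induction j with
    | zero => rw [A_zero_left, A_zero_right]
    | succ j jh =>
      rw [A_succ, A_succ, ih j, ih (j + 1), jh, max_comm]
      have : X i j ↔ X j i := ⟨hs _ _, hs _ _⟩
      by_cases hx : X i j
      · rw [if_pos hx, if_pos (this.1 hx)]
      · rw [if_neg hx, if_neg (fun h => hx (this.2 h))]

theorem A_inv (h : PP b X) : ∀ s i j, i + j = s → A b X (i + 1) j = A b X i j ∨
    (A b X (i + 1) j = A b X i j + 1 ∧ (b (i + 1) = b i + 1 ∨ ∃ k < j, X i k)) := by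
  intro s
  induction s with
  | zero =>
    intro i j hij
    obtain ⟨rfl, rfl⟩ : i = 0 ∧ j = 0 := by omega
    rw [A_zero_right, A_zero_right]
    rcases h.hb 0 with h1 | h1 <;> simp [h1]
  | succ s ih =>
    intro i j hij
    cases j with
    | zero =>
      rw [A_zero_right, A_zero_right]
      rcases h.hb i with h1 | h1 <;> simp [h1]
    | succ j =>
      have h1 := ih i j (by omega)
      have h2 := ih j i (by omega)
      rw [A_symm h.hs (j + 1) i, A_symm h.hs j i] at h2
      rw [A_succ]
      split_ifs with hx
      · have e2 : A b X i (j + 1) = A b X i j := by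
          rcases h2 with h2 | ⟨_, h2 | ⟨k, hk, h2⟩⟩
          · exact h2
          · exact absurd (h.hs _ _ hx) (h.hbc _ _ h2)
          · have := h.hc _ _ _ h2 (h.hs _ _ hx); omega
        right
        exact ⟨by omega, Or.inr ⟨j, by omega, hx⟩⟩
      · rcases h1 with h1 | ⟨h1, h3⟩
        · left; rw [h1]; rcases h2 with h2 | ⟨h2, _⟩ <;> rw [h2] <;> simp
        · rcases h2 with h2 | ⟨h2, _⟩
          · right
            refine ⟨by rw [h1, h2]; simp, ?_⟩
            rcases h3 with h3 | ⟨k, hk, h3⟩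
            · exact Or.inl h3
            · exact Or.inr ⟨k, by omega, h3⟩
          · left; rw [h1, h2]; simp

theorem inv1 (h : PP b X) (i j : ℕ) : A b X (i + 1) j = A b X i j ∨
    (A b X (i + 1) j = A b X i j + 1 ∧ (b (i + 1) = b i + 1 ∨ ∃ k < j, X i k)) :=
  A_inv h _ i j rfl

theorem inv2 (h : PP b X) (i j : ℕ) : A b X i (j + 1) = A b X i j ∨
    (A b X i (j + 1) = A b X i j + 1 ∧ (b (j + 1) = b j + 1 ∨ ∃ k < i, X k j)) := by
  rw [A_symm h.hs i, A_symm h.hs i]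
  rcases inv1 h j i with h1 | ⟨h1, h2 | ⟨k, hk, h2⟩⟩
  · exact Or.inl h1
  · exact Or.inr ⟨h1, Or.inl h2⟩
  · exact Or.inr ⟨h1, Or.inr ⟨k, hk, h.hs _ _ h2⟩⟩

theorem cell (h : PP b X) (i j : ℕ) : Cell (X i j) (nx b X i j)
    (A b X i j) (A b X (i + 1) j) (A b X i (j + 1)) (A b X (i + 1) (j + 1)) := by
  have h1 := inv1 h i j
  have h2 := inv2 h i j
  unfold Cell nx
  by_cases hx : X i j
  · have e1 : A b X (i + 1) j = A b X i j := by
      rcases h1 with h1 | ⟨_, h1 | ⟨k, hk, h1⟩⟩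
      · exact h1
      · exact absurd hx (h.hbc _ _ h1)
      · have := h.hc _ _ _ hx h1; omega
    have e2 : A b X i (j + 1) = A b X i j := by
      rcases h2 with h2 | ⟨_, h2 | ⟨k, hk, h2⟩⟩
      · exact h2
      · exact absurd (h.hs _ _ hx) (h.hbc _ _ h2)
      · have := h.hc _ _ _ (h.hs _ _ hx) (h.hs _ _ h2); omega
    left
    refine ⟨hx, by omega, e1, e2, by rw [A_succ]; simp [hx]⟩
  · have e : A b X (i + 1) (j + 1) = max (A b X i (j + 1)) (A b X (i + 1) j) := by
      rw [A_succ]; simp [hx]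
    rw [e]
    simp only [hx, not_false_eq_true, true_and, false_and, false_or]
    rcases h1 with h1 | ⟨h1, _⟩ <;> rcases h2 with h2 | ⟨h2, _⟩ <;> rw [h1, h2] <;> simp

theorem nx_symm (hs : ∀ i j, X i j → X j i) (i j : ℕ) (h : nx b X i j) : nx b X j i := by
  unfold nx at *
  rw [A_symm hs (j + 1), A_symm hs j i, A_symm hs j]
  exact ⟨h.2, h.1⟩

/-- if the difference goes from 0 to 1, there was a point -/
theorem step_ex (h : PP b X) (i j : ℕ) (h0 : A b X (i + 1) j = A b X i j) :
    ∀ k, j ≤ k → A b X (i + 1) k = A b X i k + 1 → ∃ z, j ≤ z ∧ z < k ∧ X i z := by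
  intro k hk
  induction k, hk using Nat.le_induction with
  | base => intro h1; omega
  | succ k hk ih =>
    intro h1
    by_cases hx : X i k
    · exact ⟨k, hk, by omega, hx⟩
    · have hc := cell h i k
      unfold Cell at hc
      obtain ⟨z, h2, h3, h4⟩ := ih (by grind)
      exact ⟨z, h2, by omega, h4⟩

theorem nx_uniq (h : PP b X) (i j k : ℕ) (h1 : nx b X i j) (h2 : nx b X i k) : j = k := by
  have key : ∀ j k, nx b X i j → nx b X i k → j < k → False := by
    intro j k h1 h2 hjk
    have hc := cell h i j
    have e : A b X (i + 1) (j + 1) = A b X i (j + 1) := by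
      unfold Cell at hc; grind
    obtain ⟨z, hz1, hz2, hz⟩ := step_ex h i (j + 1) e k hjk h2.1
    rcases inv1 h i j with h3 | ⟨h3, h4 | ⟨y, hy, h4⟩⟩
    · have := h1.1; omega
    · exact h.hbc _ _ h4 hz
    · have := h.hc _ _ _ hz h4; omega
  rcases lt_trichotomy j k with h3 | h3 | h3
  · exact (key _ _ h1 h2 h3).elim
  · exact h3
  · exact (key _ _ h2 h1 h3).elim

/-- after a point (or a boundary step), the difference stays 1 until something is passed on -/
theorem persist (h : PP b X) (i j : ℕ) (h0 : A b X (i + 1) j = A b X i j + 1) :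
    ∀ k, j ≤ k → (∀ z, j ≤ z → z < k → ¬ nx b X i z) → A b X (i + 1) k = A b X i k + 1 := by
  intro k hk
  induction k, hk using Nat.le_induction with
  | base => intro _; exact h0
  | succ k hk ih =>
    intro h1
    have h2 := ih (fun z hz hz' => h1 z hz (by omega))
    have h3 := h1 k hk (by omega)
    have hc := cell h i k
    unfold Cell at hc
    grind

theorem A_nx_le (h : PP b X) (b' : ℕ → ℕ) (c : ℕ) (hb : ∀ i, b' i ≤ b i + c) :
    ∀ i j, A b' (nx b X) i j ≤ A b X i j + c := by
  intro i
  induction i with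
  | zero => intro j; rw [A_zero_left, A_zero_left]; exact hb j
  | succ i ih =>
    intro j
    induction j with
    | zero => rw [A_zero_right, A_zero_right]; exact hb _
    | succ j jh =>
      have h1 := ih j
      have h2 := ih (j + 1)
      have hc := cell h i j
      unfold Cell at hc
      rw [A_succ b']
      split_ifs with hx <;> grind

theorem A_mono_right (h : PP b X) (i j k : ℕ) (hjk : j ≤ k) : A b X i j ≤ A b X i k := by
  induction k, hjk using Nat.le_induction with
  | base => exact le_rfl
  | succ k hk ih => rcases inv2 h i k with h1 | ⟨h1, _⟩ <;> omega

theorem A_mono_left (h : PP b X) (i j k : ℕ) (hjk : j ≤ k) : A b X j i ≤ A b X k i := by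
  rw [A_symm h.hs j, A_symm h.hs k]; exact A_mono_right h i j k hjk

/-- Anything satisfying the local rule with zero boundary is the growth diagram. -/
theorem determinism (n : ℕ) (X X' : ℕ → ℕ → Prop) (a : ℕ → ℕ → ℕ)
    (h0 : ∀ j ≤ n, a 0 j = 0) (h0' : ∀ i ≤ n, a i 0 = 0)
    (hc : ∀ i < n, ∀ j < n, Cell (X i j) (X' i j) (a i j) (a (i + 1) j) (a i (j + 1))
      (a (i + 1) (j + 1))) :
    (∀ i ≤ n, ∀ j ≤ n, A (fun _ => 0) X i j = a i j) ∧
    (∀ i < n, ∀ j < n, (nx (fun _ => 0) X i j ↔ X' i j)) := by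
  have key : ∀ i ≤ n, ∀ j ≤ n, A (fun _ => 0) X i j = a i j := by
    intro i
    induction i with
    | zero => intro _ j hj; rw [A_zero_left, h0 j hj]
    | succ i ih =>
      intro hi j
      induction j with
      | zero => intro _; rw [A_zero_right, h0' _ hi]
      | succ j jh =>
        intro hj
        have h1 := ih (by omega) j (by omega)
        have h2 := ih (by omega) (j + 1) (by omega)
        have h3 := jh (by omega)
        have := hc i (by omega) j (by omega)
        rw [A_succ, h1, h2, h3]
        unfold Cell at this
        split_ifs with hx <;> grind
  refine ⟨key, ?_⟩
  intro i hi j hj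
  have := hc i hi j hj
  unfold nx
  rw [key i (by omega) j (by omega), key (i + 1) (by omega) j (by omega),
    key i (by omega) (j + 1) (by omega)]
  unfold Cell at this
  grind

/-- zero boundary -/
abbrev Z : ℕ → ℕ := fun _ => 0

theorem PP.next (h : PP Z X) : PP Z (nx Z X) where
  hb := fun _ => Or.inl rfl
  hs := nx_symm h.hs
  hc := fun i j k h1 h2 => nx_uniq h i j k h1 h2
  hbc := fun i j h1 => by simp [Z] at h1

theorem src1 (h : PP Z X) {i j : ℕ} (h1 : A Z X (i + 1) j = A Z X i j + 1) : ∃ k < j, X i k := by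
  rcases inv1 h i j with h2 | ⟨_, h2 | h2⟩
  · omega
  · simp [Z] at h2
  · exact h2

theorem src2 (h : PP Z X) {i j : ℕ} (h1 : A Z X i (j + 1) = A Z X i j + 1) : ∃ k < i, X k j := by
  rcases inv2 h i j with h2 | ⟨_, h2 | h2⟩
  · omega
  · simp [Z] at h2
  · exact h2

/-- a point creates a step -/
theorem pt_step (h : PP b X) {i j : ℕ} (hx : X i j) :
    A b X (i + 1) (j + 1) = A b X i (j + 1) + 1 ∧
    A b X (i + 1) (j + 1) = A b X (i + 1) j + 1 := by
  have hc := cell h i j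
  unfold Cell at hc
  grind

theorem step_nx (h : PP Z X) (n i : ℕ) (hn : ∀ i j, X i j → j < n) :
    A Z X (i + 1) n = A Z X i n + 1 ↔ (∃ j, X i j) ∧ ¬ ∃ j, nx Z X i j := by
  constructor
  · intro h1
    obtain ⟨k, hk, hx⟩ := src1 h h1
    refine ⟨⟨k, hx⟩, ?_⟩
    rintro ⟨z, hz⟩
    obtain ⟨y, hy, hxy⟩ := src1 h hz.1
    obtain ⟨u, hu, hxu⟩ := src2 h hz.2
    have hzn := hn _ _ hxu
    have hc := cell h i z
    have e : A Z X (i + 1) (z + 1) = A Z X i (z + 1) := by unfold Cell at hc; grind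
    obtain ⟨v, hv1, hv2, hv⟩ := step_ex h i (z + 1) e n (by omega) h1
    have := h.hc _ _ _ hxy hv
    omega
  · rintro ⟨⟨j, hj⟩, h2⟩
    have h3 := (pt_step h hj).1
    exact persist h i (j + 1) h3 n (hn _ _ hj) (fun z _ _ hz => h2 ⟨z, hz⟩)

theorem step_or (h : PP b X) (n i : ℕ) : A b X (i + 1) n = A b X i n + 1 ∨ A b X (i + 1) n = A b X i n := by
  rcases inv1 h i n with h1 | h1
  · exact Or.inr h1
  · exact Or.inl h1.1

/-! descents -/

theorem asc_step (h : PP Z X) {i y y' z' : ℕ} (h1 : X i y) (h2 : X (i + 1) y') (hy : y < y')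
    (hz : nx Z X (i + 1) z') : ∃ z < z', nx Z X i z := by
  by_contra hcon
  push Not at hcon
  obtain ⟨k, hk, hxk⟩ := src1 h hz.1
  have := h.hc _ _ _ h2 hxk
  have h3 := persist h i (y + 1) (pt_step h h1).1 z' (by omega) (fun z _ hz => hcon z hz)
  have hc := cell h i z'
  have := hz.2
  unfold Cell at hc
  grind

theorem desc_step (h : PP Z X) {i y y' : ℕ} (h1 : X i y) (h2 : X (i + 1) y') (hy : y' < y) :
    ∃ z' ≤ y, nx Z X (i + 1) z' := by
  by_contra hcon
  push Not at hcon
  have h3 := persist h (i + 1) (y' + 1) (pt_step h h2).1 y (by omega)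
    (fun z _ hz => hcon z (by omega))
  have h4 := (pt_step h h1).2
  exact hcon y le_rfl ⟨h3, h4⟩

/-! increasing chains -/

def Inc (X : ℕ → ℕ → Prop) : ℕ → ℕ → ℕ → Prop
  | 0, _, _ => True
  | m + 1, x, y => ∃ x' y', x' < x ∧ y' < y ∧ X x' y' ∧ Inc X m x' y'

theorem inc_le (h : PP Z X) : ∀ m x y, Inc X m x y → m ≤ A Z X x y := by
  intro m
  induction m with
  | zero => intros; omega
  | succ m ih =>
    rintro x y ⟨x', y', h1, h2, h3, h4⟩
    have h5 := ih _ _ h4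
    have hc := cell h x' y'
    have : A Z X (x' + 1) (y' + 1) = A Z X x' y' + 1 := by unfold Cell at hc; grind
    have h6 := A_mono_right h (x' + 1) (y' + 1) y h2
    have h7 := A_mono_left h y (x' + 1) x h1
    omega

theorem inc_of_le (h : PP Z X) : ∀ s m x y, x + y = s → m ≤ A Z X x y → Inc X m x y := by
  have mono : ∀ m x y x2 y2, x ≤ x2 → y ≤ y2 → Inc X m x y → Inc X m x2 y2 := by
    intro m x y x2 y2 hx hy
    cases m with
    | zero => intro _; trivial
    | succ m =>
      rintro ⟨x', y', h1, h2, h3⟩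
      exact ⟨x', y', by omega, by omega, h3⟩
  intro s
  induction s using Nat.strong_induction_on with
  | _ s ih =>
    intro m x y hxy hm
    cases m with
    | zero => trivial
    | succ m =>
      cases x with
      | zero => rw [A_zero_left] at hm; simp [Z] at hm
      | succ x =>
        cases y with
        | zero => rw [A_zero_right] at hm; simp [Z] at hm
        | succ y =>
          rw [A_succ] at hm
          split_ifs at hm with hx
          · exact ⟨x, y, by omega, by omega, hx, ih (x + y) (by omega) m x y rfl (by omega)⟩
          · rcases le_max_iff.1 hm with hm | hm
            · exact mono _ _ _ _ _ (by omega) le_rfl (ih (x + (y + 1)) (by omega) _ _ _ rfl hm)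
            · exact mono _ _ _ _ _ le_rfl (by omega) (ih (x + 1 + y) (by omega) _ _ _ rfl hm)

/-! decreasing chains -/

def Dec (S : ℕ → ℕ → Prop) : ℕ → ℕ → ℕ → Prop
  | 0, _, _ => True
  | m + 1, x, y => ∃ x' y', x ≤ x' ∧ y' < y ∧ S x' y' ∧ Dec S m (x' + 1) y'

theorem Dec.mono {S : ℕ → ℕ → Prop} {m x y x2 y2 : ℕ} (hx : x2 ≤ x) (hy : y ≤ y2)
    (h : Dec S m x y) : Dec S m x2 y2 := by
  cases m with
  | zero => trivial
  | succ m =>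
    obtain ⟨x', y', h1, h2, h3⟩ := h
    exact ⟨x', y', by omega, by omega, h3⟩

theorem Dec.congr {S T : ℕ → ℕ → Prop} (c : ℕ) (hST : ∀ x y, c ≤ x → S x y → T x y) :
    ∀ m x y, c ≤ x → Dec S m x y → Dec T m x y := by
  intro m
  induction m with
  | zero => intros; trivial
  | succ m ih =>
    rintro x y hx ⟨x', y', h1, h2, h3, h4⟩
    exact ⟨x', y', h1, h2, hST _ _ (by omega) h3, ih _ _ (by omega) h4⟩

/-- Exchange of two adjacent columns preserves the lengths of decreasing chains. -/
theorem Dec.exch {S T : ℕ → ℕ → Prop} (c : ℕ)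
    (hST : ∀ x y, x ≠ c → x ≠ c + 1 → S x y → T x y)
    (h1 : ∀ y, S c y → T c y ∨ T (c + 1) y)
    (h2 : ∀ y, S (c + 1) y → T c y ∨ T (c + 1) y)
    (h3 : ∀ y y', S c y → S (c + 1) y' → y' < y →
      ∃ z z', T c z ∧ T (c + 1) z' ∧ z ≤ y ∧ z' < z ∧ y' ≤ z') :
    ∀ m x y, x ≤ c → Dec S m x y → Dec T m x y := by
  have late : ∀ m x y, c + 2 ≤ x → Dec S m x y → Dec T m x y :=
    Dec.congr (c + 2) (fun x y hx => hST x y (by omega) (by omega))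
  have one : ∀ m x y y', x ≤ c → y' < y → (T c y' ∨ T (c + 1) y') → Dec T m (c + 2) y' →
      Dec T (m + 1) x y := by
    intro m x y y' hx hy hT hD
    rcases hT with hT | hT
    · exact ⟨c, y', hx, hy, hT, hD.mono (by omega) le_rfl⟩
    · exact ⟨c + 1, y', by omega, hy, hT, hD⟩
  intro m
  induction m with
  | zero => intros; trivial
  | succ m ih =>
    rintro x y hx ⟨x', y', hxx, hyy, hS, hD⟩
    rcases lt_trichotomy x' c with hc | hc | hc
    · exact ⟨x', y', hxx, hyy, hST _ _ (by omega) (by omega) hS, ih _ _ hc hD⟩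
    · subst hc
      cases m with
      | zero => exact one _ _ _ _ hx hyy (h1 _ hS) trivial
      | succ m =>
        obtain ⟨x2, y2, h4, h5, h6, h7⟩ := hD
        rcases Nat.eq_or_lt_of_le h4 with h8 | h8
        · subst h8
          obtain ⟨z, z', a1, a2, a3, a4, a5⟩ := h3 _ _ hS h6 h5
          exact ⟨x', z, hxx, by omega, a1, x' + 1, z', le_rfl, a4, a2,
            (late _ _ _ (by omega) h7).mono le_rfl a5⟩
        · exact one _ _ _ _ hx hyy (h1 _ hS)
            (late (m + 1) _ _ (by omega) ⟨x2, y2, h8, h5, h6, h7⟩)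
    · rcases Nat.eq_or_lt_of_le hc with h8 | h8
      · have : x' = c + 1 := by omega
        subst this
        exact one _ _ _ _ hx hyy (h2 _ hS) (late _ _ _ (by omega) hD)
      · exact ⟨x', y', hxx, hyy, hST _ _ (by omega) (by omega) hS, late _ _ _ (by omega) hD⟩

/-- The interpolating configuration at time `t`. -/
def SS (X : ℕ → ℕ → Prop) (t c y : ℕ) : Prop :=
  (c < t ∧ nx Z X c y) ∨ (c = t ∧ A Z X t (y + 1) = A Z X t y + 1) ∨ (t < c ∧ X (c - 1) y)

theorem SS_lt {t c y : ℕ} (h : c < t) : SS X t c y ↔ nx Z X c y := by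
  unfold SS; constructor
  · rintro (h1 | h1 | h1)
    · exact h1.2
    · omega
    · omega
  · intro h1; exact Or.inl ⟨h, h1⟩

theorem SS_eq {t y : ℕ} : SS X t t y ↔ A Z X t (y + 1) = A Z X t y + 1 := by
  unfold SS; simp

theorem SS_gt {t c y : ℕ} (h : t < c) : SS X t c y ↔ X (c - 1) y := by
  unfold SS; constructor
  · rintro (h1 | h1 | h1)
    · omega
    · omega
    · exact h1.2
  · intro h1; exact Or.inr (Or.inr ⟨h, h1⟩)

theorem SS_step (h : PP Z X) (t m y : ℕ) : Dec (SS X t) m 0 y ↔ Dec (SS X (t + 1)) m 0 y := by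
  constructor
  · apply Dec.exch t _ _ _ _ m 0 y (by omega)
    · intro x y h1 h2 hS
      rcases lt_or_ge x t with h3 | h3
      · rw [SS_lt h3] at hS; rwa [SS_lt (by omega)]
      · rw [SS_gt (by omega)] at hS; rwa [SS_gt (by omega)]
    · intro y hS
      rw [SS_eq] at hS
      rw [SS_lt (by omega), SS_eq]
      have hc := cell h t y
      unfold Cell at hc
      grind
    · intro y hS
      rw [SS_gt (by omega), Nat.add_sub_cancel] at hS
      right
      rw [SS_eq]; exact (pt_step h hS).2
    · intro y y' h1 h2 hy
      rw [SS_eq] at h1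
      rw [SS_gt (by omega), Nat.add_sub_cancel] at h2
      have : ∃ z ≤ y, nx Z X t z := by
        by_contra hcon
        push Not at hcon
        have h3 := persist h t (y' + 1) (pt_step h h2).1 y (by omega)
          (fun z _ hz => hcon z (by omega))
        exact hcon y le_rfl ⟨h3, h1⟩
      obtain ⟨z, hz, hnx⟩ := this
      obtain ⟨k, hk, hxk⟩ := src1 h hnx.1
      have := h.hc _ _ _ h2 hxk
      exact ⟨z, y', (SS_lt (by omega)).2 hnx, SS_eq.2 (pt_step h h2).2, hz, by omega, le_rfl⟩
  · apply Dec.exch t _ _ _ _ m 0 y (by omega)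
    · intro x y h1 h2 hS
      rcases lt_or_ge x t with h3 | h3
      · rw [SS_lt (by omega)] at hS; rwa [SS_lt (by omega)]
      · rw [SS_gt (by omega)] at hS; rwa [SS_gt (by omega)]
    · intro y hS
      rw [SS_lt (by omega)] at hS
      left; rw [SS_eq]; exact hS.2
    · intro y hS
      rw [SS_eq] at hS
      rw [SS_eq, SS_gt (by omega), Nat.add_sub_cancel]
      have hc := cell h t y
      unfold Cell at hc
      grind
    · intro z y' h1 h2 hy
      rw [SS_lt (by omega)] at h1
      rw [SS_eq] at h2
      obtain ⟨x, hx, hxk⟩ := src1 h h1.1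
      refine ⟨z, x, SS_eq.2 h1.2, (SS_gt (by omega)).2 hxk, le_rfl, hx, ?_⟩
      by_contra hcon
      push Not at hcon
      have h3 := persist h t (x + 1) (pt_step h hxk).1 y' (by omega) (fun u _ hu hn => by
        have := nx_uniq h _ _ _ h1 hn
        omega)
      have hc := cell h t y'
      unfold Cell at hc
      grind

theorem Dec_shift {S T : ℕ → ℕ → Prop} (hST : ∀ x y, S (x + 1) y ↔ T x y) :
    ∀ m x y, Dec S m (x + 1) y ↔ Dec T m x y := by
  intro m
  induction m with
  | zero => intros; simp [Dec]
  | succ m ih =>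
    intro x y
    constructor
    · rintro ⟨x', y', h1, h2, h3, h4⟩
      obtain ⟨x'', rfl⟩ : ∃ k, x' = k + 1 := ⟨x' - 1, by omega⟩
      exact ⟨x'', y', by omega, h2, (hST _ _).1 h3, (ih _ _).1 h4⟩
    · rintro ⟨x', y', h1, h2, h3, h4⟩
      exact ⟨x' + 1, y', by omega, h2, (hST _ _).2 h3, (ih _ _).2 h4⟩

theorem Dec_nx (h : PP Z X) (n m : ℕ) (hn : ∀ i j, X i j → i < n) :
    Dec X (m + 2) 0 n ↔ Dec (nx Z X) (m + 1) 0 n := by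
  have hnj : ∀ i j, X i j → j < n := fun i j hx => hn _ _ (h.hs _ _ hx)
  have hnn : ∀ i j, nx Z X i j → i < n := fun i j hx => by
    obtain ⟨k, _, hk⟩ := src1 h hx.1
    exact hn _ _ hk
  have e0 : Dec X (m + 2) 0 n ↔ Dec (SS X 0) (m + 2) 0 n := by
    rw [← Dec_shift (S := SS X 0) (T := X) (fun x y => by rw [SS_gt (by omega)]; simp)]
    constructor
    · exact fun hD => hD.mono (by omega) le_rfl
    · rintro ⟨x', y', h1, h2, h3, h4⟩
      have : 0 < x' := by
        by_contra hx
        obtain rfl : x' = 0 := by omega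
        rw [SS_eq, A_zero_left, A_zero_left] at h3
        simp [Z] at h3
      exact ⟨x', y', this, h2, h3, h4⟩
  have e1 : ∀ t, Dec (SS X 0) (m + 2) 0 n ↔ Dec (SS X t) (m + 2) 0 n := by
    intro t
    induction t with
    | zero => rfl
    | succ t ih => rw [ih, SS_step h]
  rw [e0, e1 n]
  have nogt : ∀ x y, n < x → ¬ SS X n x y := by
    intro x y hx hS
    rw [SS_gt hx] at hS
    have := hn _ _ hS
    omega
  have fwd : ∀ m x y, x ≤ n → Dec (SS X n) (m + 1) x y → Dec (nx Z X) m x y := by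
    intro m
    induction m with
    | zero => intros; trivial
    | succ m ih =>
      rintro x y hx ⟨x', y', h1, h2, h3, h4⟩
      have hlt : x' < n := by
        by_contra hge
        obtain ⟨x2, y2, h5, h6, h7, h8⟩ := h4
        exact nogt _ _ (by omega) h7
      rw [SS_lt hlt] at h3
      exact ⟨x', y', h1, h2, h3, ih _ _ hlt h4⟩
  have bwd : ∀ m x y, Dec (nx Z X) (m + 1) x y → Dec (SS X n) (m + 2) x y := by
    intro m
    induction m with
    | zero =>
      rintro x y ⟨x', y', h1, h2, h3, h4⟩
      have hx' := hnn _ _ h3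
      refine ⟨x', y', h1, h2, (SS_lt hx').2 h3, ?_⟩
      obtain ⟨k, hk, hxk⟩ := src2 h h3.2
      have hpos : 0 < A Z X n y' := by
        have := h3.1
        have h5 := A_mono_left h y' (x' + 1) n hx'
        omega
      have : ∃ z < y', A Z X n (z + 1) = A Z X n z + 1 := by
        by_contra hcon
        push Not at hcon
        have : ∀ z ≤ y', A Z X n z = 0 := by
          intro z
          induction z with
          | zero => intro _; rw [A_zero_right]
          | succ z ihz =>
            intro hz
            have e := hcon z (by omega)
            have e2 := ihz (by omega)
            rcases inv2 h n z with h6 | ⟨h6, _⟩ <;> omega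
        have := this y' le_rfl
        omega
      obtain ⟨z, hz, hA⟩ := this
      exact ⟨n, z, by omega, hz, SS_eq.2 hA, trivial⟩
    | succ m ih =>
      rintro x y ⟨x', y', h1, h2, h3, h4⟩
      have hx' := hnn _ _ h3
      exact ⟨x', y', h1, h2, (SS_lt hx').2 h3, ih _ _ h4⟩
  exact ⟨fwd _ _ _ (by omega), bwd _ _ _⟩

/-! levels -/

def lev (X : ℕ → ℕ → Prop) : ℕ → ℕ → ℕ → Prop
  | 0 => X
  | r + 1 => nx Z (lev X r)

theorem lev_PP (h : PP Z X) : ∀ r, PP Z (lev X r)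
  | 0 => h
  | r + 1 => (lev_PP h r).next

theorem lev_supp (h : PP Z X) (n : ℕ) (hn : ∀ i j, X i j → i < n) :
    ∀ r i j, lev X r i j → i < n := by
  intro r
  induction r with
  | zero => exact hn
  | succ r ih =>
    intro i j hx
    obtain ⟨k, _, hk⟩ := src1 (lev_PP h r) hx.1
    exact ih _ _ hk

theorem lev_ge (h : PP Z X) : ∀ r i j, lev X r i j → r ≤ i := by
  intro r
  induction r with
  | zero => intros; omega
  | succ r ih =>
    intro i j hx
    obtain ⟨k, h1, hk⟩ := src2 (lev_PP h r) hx.2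
    have := ih _ _ hk
    omega

theorem act_anti (h : PP Z X) {i : ℕ} {r s : ℕ} (hrs : r ≤ s) (hs : ∃ j, lev X s i j) :
    ∃ j, lev X r i j := by
  induction s, hrs using Nat.le_induction with
  | base => exact hs
  | succ s _ ih =>
    obtain ⟨j, hj⟩ := hs
    obtain ⟨k, _, hk⟩ := src1 (lev_PP h s) hj.1
    exact ih ⟨k, hk⟩

open Classical in
/-- the row in which position `i` terminates -/
noncomputable def wd (X : ℕ → ℕ → Prop) (i : ℕ) : ℕ :=
  Nat.findGreatest (fun r => ∃ j, lev X r i j) i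

open Classical in
theorem wd_le (i : ℕ) : wd X i ≤ i := by
  unfold wd; exact Nat.findGreatest_le _

open Classical in
theorem act_iff (h : PP Z X) {i : ℕ} (h0 : ∃ j, X i j) (r : ℕ) :
    (∃ j, lev X r i j) ↔ r ≤ wd X i := by
  constructor
  · intro hr
    obtain ⟨j, hj⟩ := hr
    exact Nat.le_findGreatest (lev_ge h _ _ _ hj) ⟨j, hj⟩
  · intro hr
    refine act_anti h hr ?_
    exact Nat.findGreatest_spec (P := fun r => ∃ j, lev X r i j) (m := 0) (Nat.zero_le _) h0

def cnt (w : ℕ → ℕ) (r i : ℕ) : ℕ := ((Finset.range i).filter (fun k => w k = r)).card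

theorem cnt_zero (w : ℕ → ℕ) (r : ℕ) : cnt w r 0 = 0 := by simp [cnt]

theorem cnt_succ (w : ℕ → ℕ) (r i : ℕ) :
    cnt w r (i + 1) = cnt w r i + if w i = r then 1 else 0 := by
  unfold cnt
  rw [Finset.range_add_one, Finset.filter_insert]
  split_ifs with h
  · rw [Finset.card_insert_of_notMem (by simp)]
  · simp

theorem cnt_mono (w : ℕ → ℕ) (r : ℕ) {i j : ℕ} (h : i ≤ j) : cnt w r i ≤ cnt w r j := by
  induction j, h using Nat.le_induction with
  | base => exact le_rfl
  | succ j _ ih => rw [cnt_succ]; omega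

theorem cnt_congr {w w' : ℕ → ℕ} (r : ℕ) {n : ℕ} (h : ∀ i < n, w i = w' i) :
    ∀ i ≤ n, cnt w r i = cnt w' r i := by
  intro i
  induction i with
  | zero => intro _; rw [cnt_zero, cnt_zero]
  | succ i ih => intro hi; rw [cnt_succ, cnt_succ, ih (by omega), h i (by omega)]

/-- full symmetric permutation matrix of size `n` -/
structure Full (n : ℕ) (X : ℕ → ℕ → Prop) : Prop extends PP Z X where
  supp : ∀ i j, X i j → i < n
  full : ∀ i < n, ∃ j, X i j

theorem cnt_wd {n : ℕ} (h : Full n X) (r : ℕ) :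
    ∀ i ≤ n, A Z (lev X r) i n = cnt (wd X) r i := by
  intro i
  induction i with
  | zero => intro _; rw [A_zero_left, cnt_zero]
  | succ i ih =>
    intro hi
    have hP := lev_PP h.toPP r
    have h1 := step_nx hP n i
      (fun i j hx => lev_supp h.toPP n h.supp r j i (hP.hs _ _ hx))
    have h2 := step_or hP n i
    have e : nx Z (lev X r) = lev X (r + 1) := rfl
    rw [e, act_iff h.toPP (h.full i (by omega)), act_iff h.toPP (h.full i (by omega))] at h1
    rw [cnt_succ, ← ih (by omega)]
    split_ifs with hw
    · exact h1.2 (by omega)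
    · rcases h2 with h2 | h2
      · have := h1.1 h2; omega
      · omega

structure Lat (n : ℕ) (w : ℕ → ℕ) : Prop where
  le : ∀ i, w i ≤ i
  lat : ∀ r, ∀ i ≤ n, cnt w (r + 1) i ≤ cnt w r i

theorem lat_wd {n : ℕ} (h : Full n X) : Lat n (wd X) where
  le := wd_le
  lat := by
    intro r i hi
    rw [← cnt_wd h _ _ hi, ← cnt_wd h _ _ hi]
    exact A_nx_le (lev_PP h.toPP r) Z 0 (fun _ => le_rfl) i n

theorem wd_asc {n : ℕ} (h : Full n X) {i y y' : ℕ} (h1 : X i y) (h2 : X (i + 1) y')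
    (hy : y < y') : wd X (i + 1) ≤ wd X i := by
  have key : ∀ r z', lev X r (i + 1) z' → ∃ z < z', lev X r i z := by
    intro r
    induction r with
    | zero =>
      intro z' hz'
      have := h.hc _ _ _ h2 hz'
      exact ⟨y, by omega, h1⟩
    | succ r ih =>
      intro z' hz'
      obtain ⟨k, _, hk⟩ := src1 (lev_PP h.toPP r) hz'.1
      obtain ⟨z, hz, hz2⟩ := ih k hk
      exact asc_step (lev_PP h.toPP r) hz2 hk hz hz'
  obtain ⟨z', hz'⟩ := (act_iff h.toPP ⟨y', h2⟩ (wd X (i + 1))).2 le_rfl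
  obtain ⟨z, _, hz⟩ := key _ _ hz'
  exact (act_iff h.toPP ⟨y, h1⟩ _).1 ⟨z, hz⟩

theorem wd_desc {n : ℕ} (h : Full n X) {i y y' : ℕ} (h1 : X i y) (h2 : X (i + 1) y')
    (hy : y' < y) : wd X i < wd X (i + 1) := by
  have key : ∀ r z, lev X r i z → ∃ z' < z, lev X r (i + 1) z' := by
    intro r
    induction r with
    | zero =>
      intro z hz
      have := h.hc _ _ _ h1 hz
      exact ⟨y', by omega, h2⟩
    | succ r ih =>
      intro z hz
      obtain ⟨k, hkz, hk⟩ := src1 (lev_PP h.toPP r) hz.1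
      obtain ⟨k', hk', hk2⟩ := ih k hk
      obtain ⟨z', h3, h4⟩ := desc_step (lev_PP h.toPP r) hk hk2 hk'
      exact ⟨z', by omega, h4⟩
  obtain ⟨z, hz⟩ := (act_iff h.toPP ⟨y, h1⟩ (wd X i)).2 le_rfl
  obtain ⟨z', hz', h3⟩ := key _ _ hz
  obtain ⟨u, _, hu⟩ := desc_step (lev_PP h.toPP _) hz h3 hz'
  exact (act_iff h.toPP ⟨y', h2⟩ (wd X i + 1)).1 ⟨u, hu⟩

/-! injectivity -/

theorem back_det (n : ℕ) {X1 X2 Y1 Y2 : ℕ → ℕ → Prop} {a1 a2 : ℕ → ℕ → ℕ}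
    (c1 : ∀ i j, Cell (X1 i j) (Y1 i j) (a1 i j) (a1 (i + 1) j) (a1 i (j + 1))
      (a1 (i + 1) (j + 1)))
    (c2 : ∀ i j, Cell (X2 i j) (Y2 i j) (a2 i j) (a2 (i + 1) j) (a2 i (j + 1))
      (a2 (i + 1) (j + 1)))
    (hY : ∀ i < n, ∀ j < n, (Y1 i j ↔ Y2 i j))
    (hb1 : ∀ i ≤ n, a1 i n = a2 i n) (hb2 : ∀ i ≤ n, a1 n i = a2 n i) :
    ∀ i < n, ∀ j < n, (X1 i j ↔ X2 i j) := by
  have key : ∀ s ≤ n, ∀ t ≤ n, a1 (n - s) (n - t) = a2 (n - s) (n - t) := by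
    intro s
    induction s with
    | zero => intro _ t _; exact hb2 _ (by omega)
    | succ s ih =>
      intro hs t
      induction t with
      | zero => intro _; exact hb1 _ (by omega)
      | succ t jh =>
        intro ht
        have e1 := ih (by omega) t (by omega)
        have e2 := ih (by omega) (t + 1) ht
        have e3 := jh (by omega)
        obtain ⟨i, hi⟩ : ∃ i, n = i + s + 1 := ⟨n - s - 1, by omega⟩
        obtain ⟨j, hj⟩ : ∃ j, n = j + t + 1 := ⟨n - t - 1, by omega⟩
        have f1 : n - s = i + 1 := by omega
        have f2 : n - t = j + 1 := by omega
        have f3 : n - (s + 1) = i := by omega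
        have f4 : n - (t + 1) = j := by omega
        rw [f1] at e1 e2; rw [f2] at e1 e3; rw [f3] at e3 ⊢; rw [f4] at e2 ⊢
        have g1 := c1 i j
        have g2 := c2 i j
        have g3 := hY i (by omega) j (by omega)
        unfold Cell at g1 g2
        grind
  have key2 : ∀ i ≤ n, ∀ j ≤ n, a1 i j = a2 i j := by
    intro i hi j hj
    have := key (n - i) (by omega) (n - j) (by omega)
    rwa [Nat.sub_sub_self hi, Nat.sub_sub_self hj] at this
  intro i hi j hj
  have g1 := c1 i j
  have g2 := c2 i j
  have g3 := hY i hi j hj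
  have e1 := key2 i (by omega) j (by omega)
  have e4 := key2 (i + 1) (by omega) (j + 1) (by omega)
  unfold Cell at g1 g2
  have e2 := key2 (i + 1) (by omega) j (by omega)
  have e3 := key2 i (by omega) (j + 1) (by omega)
  by_cases hx : X1 i j <;> by_cases hx2 : X2 i j <;> by_cases hx3 : Y1 i j <;>
    simp_all

theorem wd_inj {n : ℕ} {X Y : ℕ → ℕ → Prop} (hX : Full n X) (hY : Full n Y)
    (hw : ∀ i < n, wd X i = wd Y i) : ∀ i < n, ∀ j < n, (X i j ↔ Y i j) := by
  have key : ∀ s ≤ n, ∀ i < n, ∀ j < n, (lev X (n - s) i j ↔ lev Y (n - s) i j) := by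
    intro s
    induction s with
    | zero =>
      intro _ i hi j hj
      constructor
      · intro h; have := lev_ge hX.toPP _ _ _ h; omega
      · intro h; have := lev_ge hY.toPP _ _ _ h; omega
    | succ s ih =>
      intro hs
      have e : n - s = n - (s + 1) + 1 := by omega
      have ih' := ih (by omega)
      rw [e] at ih'
      have b1 : ∀ i ≤ n, A Z (lev X (n - (s + 1))) i n = A Z (lev Y (n - (s + 1))) i n := by
        intro i hi
        rw [cnt_wd hX _ _ hi, cnt_wd hY _ _ hi]
        exact cnt_congr _ hw i hi
      refine back_det n (cell (lev_PP hX.toPP _)) (cell (lev_PP hY.toPP _)) ih' b1 ?_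
      intro i hi
      rw [A_symm (lev_PP hX.toPP _).hs, A_symm (lev_PP hY.toPP _).hs]
      exact b1 i hi
  have := key n le_rfl
  rwa [Nat.sub_self] at this

/-! surjectivity -/

/-- reversed boundary -/
def bt (n : ℕ) (w : ℕ → ℕ) (r k : ℕ) : ℕ := cnt w r n - cnt w r (n - k)

theorem bt_step (n : ℕ) (w : ℕ → ℕ) (r k : ℕ) :
    (bt n w r (k + 1) = bt n w r k + 1 ∧ k < n ∧ w (n - 1 - k) = r) ∨
    (bt n w r (k + 1) = bt n w r k ∧ ¬ (k < n ∧ w (n - 1 - k) = r)) := by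
  unfold bt
  by_cases hk : k < n
  · have e : n - k = (n - (k + 1)) + 1 := by omega
    have e2 : n - 1 - k = n - (k + 1) := by omega
    have h1 := cnt_succ w r (n - (k + 1))
    have h2 := cnt_mono w r (i := n - (k + 1) + 1) (j := n) (by omega)
    rw [e, e2]
    by_cases hw : w (n - (k + 1)) = r
    · left
      rw [if_pos hw] at h1
      exact ⟨by omega, hk, hw⟩
    · right
      rw [if_neg hw] at h1
      exact ⟨by omega, fun h => hw h.2⟩
  · right
    refine ⟨?_, fun h => hk h.1⟩
    have e : n - (k + 1) = n - k := by omega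
    rw [e]

structure Good (n : ℕ) (w : ℕ → ℕ) (r : ℕ) (Y : ℕ → ℕ → Prop) : Prop where
  hs : ∀ i j, Y i j → Y j i
  hc : ∀ i j k, Y i j → Y i k → j = k
  supp : ∀ i j, Y i j → i < n
  act : ∀ i < n, ((∃ j, Y i j) ↔ r ≤ w (n - 1 - i))
  bd : ∀ q, r = q + 1 → ∀ i j, A (bt n w q) Y i j ≤ cnt w q n

theorem Good.PP {n : ℕ} {w : ℕ → ℕ} {r : ℕ} {Y : ℕ → ℕ → Prop} (h : Good n w (r + 1) Y) :
    PP (bt n w r) Y where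
  hb := fun i => by rcases bt_step n w r i with h1 | h1 <;> omega
  hs := h.hs
  hc := h.hc
  hbc := by
    intro i j h1 hY
    rcases bt_step n w r i with h2 | h2
    · have := (h.act i h2.2.1).1 ⟨j, hY⟩
      omega
    · omega

theorem good_top (n : ℕ) (w : ℕ → ℕ) (hw : Lat n w) : Good n w n (fun _ _ => False) where
  hs := fun _ _ h => h.elim
  hc := fun _ _ _ h => h.elim
  supp := fun _ _ h => h.elim
  act := by
    intro i hi
    have := hw.le (n - 1 - i)
    simp
    omega
  bd := by
    intro q _ i
    induction i with
    | zero => intro j; rw [A_zero_left]; unfold bt; omega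
    | succ i ih =>
      intro j
      induction j with
      | zero => rw [A_zero_right]; unfold bt; omega
      | succ j jh =>
        rw [A_succ, if_neg (fun h => h)]
        exact max_le (ih _) jh

theorem Good.top {n : ℕ} {w : ℕ → ℕ} {r : ℕ} {Y : ℕ → ℕ → Prop} (h : Good n w (r + 1) Y)
    (k : ℕ) : A (bt n w r) Y k n = cnt w r n := by
  apply le_antisymm (h.bd r rfl k n)
  have h1 := A_mono_left h.PP n 0 k (Nat.zero_le _)
  rw [A_zero_left] at h1
  have : bt n w r n = cnt w r n := by simp [bt, cnt_zero]
  omega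

theorem Good.next {n : ℕ} {w : ℕ → ℕ} {r : ℕ} {Y : ℕ → ℕ → Prop} (hw : Lat n w) 
    (h : Good n w (r + 1) Y) : Good n w r (nx (bt n w r) Y) where
  hs := nx_symm h.hs
  hc := nx_uniq h.PP
  supp := by
    intro i j hn
    rcases inv1 h.PP i j with h1 | ⟨_, h1 | ⟨k, _, h1⟩⟩
    · have := hn.1; omega
    · rcases bt_step n w r i with h2 | h2
      · exact h2.2.1
      · omega
    · exact h.supp _ _ h1
  act := by
    intro i hi
    have hA := h.act i hi
    constructor
    · rintro ⟨j, hn⟩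
      rcases inv1 h.PP i j with h1 | ⟨_, h1 | ⟨k, _, h1⟩⟩
      · have := hn.1; omega
      · rcases bt_step n w r i with h2 | h2
        · omega
        · omega
      · have := hA.1 ⟨k, h1⟩; omega
    · intro hr
      by_contra hcon
      have h1 := h.top i
      have h2 := h.top (i + 1)
      have main : ∃ j ≤ n, A (bt n w r) Y (i + 1) j = A (bt n w r) Y i j + 1 := by
        rcases Nat.eq_or_lt_of_le hr with h3 | h3
        · refine ⟨0, Nat.zero_le _, ?_⟩
          rw [A_zero_right, A_zero_right]
          rcases bt_step n w r i with h2 | h2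
          · exact h2.1
          · exact absurd ⟨hi, h3.symm⟩ h2.2
        · obtain ⟨j, hj⟩ := hA.2 h3
          exact ⟨j + 1, h.supp _ _ (h.hs _ _ hj), (pt_step h.PP hj).1⟩
      obtain ⟨j, hj, hd⟩ := main
      have := persist h.PP i j hd n hj (fun z _ _ hz => hcon ⟨z, hz⟩)
      omega
  bd := by
    intro q hq i j
    subst hq
    have h1 := h.bd (q + 1) rfl i j
    have h0 := hw.lat q n le_rfl
    have h2 := A_nx_le h.PP (bt n w q) (cnt w q n - cnt w (q + 1) n) (by
      intro k
      have h3 := hw.lat q (n - k) (by omega)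
      have h4 := cnt_mono w q (i := n - k) (j := n) (by omega)
      have h5 := cnt_mono w (q + 1) (i := n - k) (j := n) (by omega)
      unfold bt
      omega) i j
    omega

def Yb (n : ℕ) (w : ℕ → ℕ) : ℕ → ℕ → ℕ → Prop
  | 0 => fun _ _ => False
  | s + 1 => nx (bt n w (n - 1 - s)) (Yb n w s)

theorem Yb_good {n : ℕ} {w : ℕ → ℕ} (hw : Lat n w) : ∀ s ≤ n, Good n w (n - s) (Yb n w s) := by
  intro s
  induction s with
  | zero => intro _; exact good_top n w hw
  | succ s ih =>
    intro hs
    have h1 := ih (by omega)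
    have e : n - s = (n - 1 - s) + 1 := by omega
    rw [e] at h1
    have e2 : n - (s + 1) = n - 1 - s := by omega
    rw [e2]
    exact h1.next hw

def rv (n : ℕ) (Y : ℕ → ℕ → Prop) (i j : ℕ) : Prop := i < n ∧ j < n ∧ Y (n - 1 - i) (n - 1 - j)

theorem rv_full {n : ℕ} {w : ℕ → ℕ} (hw : Lat n w) : Full n (rv n (Yb n w n)) := by
  have h := Yb_good hw n le_rfl
  rw [Nat.sub_self] at h
  refine ⟨⟨fun _ => Or.inl rfl, ?_, ?_, ?_⟩, ?_, ?_⟩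
  · rintro i j ⟨h1, h2, h3⟩
    exact ⟨h2, h1, h.hs _ _ h3⟩
  · rintro i j k ⟨h1, h2, h3⟩ ⟨h4, h5, h6⟩
    have := h.hc _ _ _ h3 h6
    omega
  · intro i j h1; simp [Z] at h1
  · intro i j hx; exact hx.1
  · intro i hi
    obtain ⟨j, hj⟩ := (h.act (n - 1 - i) (by omega)).2 (Nat.zero_le _)
    have hjn := h.supp _ _ (h.hs _ _ hj)
    refine ⟨n - 1 - j, hi, by omega, ?_⟩
    have : n - 1 - (n - 1 - j) = j := by omega
    rwa [this]

theorem Cell_rev {x y : Prop} {p q s t c : ℕ} (h : Cell y x p q s t) (ht : t ≤ c) :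
    Cell x y (c - t) (c - s) (c - q) (c - p) := by
  unfold Cell at *
  rcases h with ⟨h1, h2, h3, h4, h5⟩ | ⟨h1, h2, h3, h4, h5⟩ | ⟨h1, h2, h3, h4, h5⟩ |
    ⟨h1, h2, h3, h4, h5⟩ | ⟨h1, h2, h3, h4, h5⟩ <;> subst h3 h4 h5 <;>
    simp only [h1, h2, not_true_eq_false, not_false_eq_true, true_and, false_and,
      false_or, or_false] <;> first | omega | simp

theorem lev_rv {n : ℕ} {w : ℕ → ℕ} (hw : Lat n w) : ∀ r ≤ n, ∀ i < n, ∀ j < n,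
    (lev (rv n (Yb n w n)) r i j ↔ Yb n w (n - r) (n - 1 - i) (n - 1 - j)) := by
  intro r
  induction r with
  | zero =>
    intro _ i hi j hj
    simp [lev, rv, hi, hj]
  | succ r ih =>
    intro hr
    have h := Yb_good hw (n - (r + 1)) (by omega)
    have e : n - (n - (r + 1)) = r + 1 := by omega
    rw [e] at h
    have e2 : n - r = (n - (r + 1)) + 1 := by omega
    have e3 : n - 1 - (n - (r + 1)) = r := by omega
    have ih' := ih (by omega)
    rw [e2] at ih'
    simp only [Yb, e3] at ih'
    have hbt : bt n w r n = cnt w r n := by simp [bt, cnt_zero]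
    have hsym := A_symm (b := bt n w r) h.hs
    have z1 : ∀ j ≤ n, cnt w r n - A (bt n w r) (Yb n w (n - (r + 1))) (n - 0) (n - j) = 0 := by
      intro j hj
      have h1 := A_mono_right h.PP n 0 (n - j) (Nat.zero_le _)
      rw [A_zero_right, hbt] at h1
      simp only [Nat.sub_zero]
      omega
    have hd := determinism n (lev (rv n (Yb n w n)) r)
      (fun i j => Yb n w (n - (r + 1)) (n - 1 - i) (n - 1 - j))
      (fun i j => cnt w r n - A (bt n w r) (Yb n w (n - (r + 1))) (n - i) (n - j))
      z1 (fun i hi => by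
        have := z1 i hi
        rw [hsym] at this
        exact this) (by
        intro i hi j hj
        have hc := cell h.PP (n - 1 - i) (n - 1 - j)
        have f1 : n - 1 - i + 1 = n - i := by omega
        have f2 : n - 1 - j + 1 = n - j := by omega
        have f3 : n - (i + 1) = n - 1 - i := by omega
        have f4 : n - (j + 1) = n - 1 - j := by omega
        rw [f1, f2] at hc
        rw [← ih' i hi j hj] at hc
        simp only [f3, f4]
        have b4 := h.bd r rfl (n - i) (n - j)
        exact Cell_rev hc b4)
    exact hd.2

theorem wd_rv {n : ℕ} {w : ℕ → ℕ} (hw : Lat n w) : ∀ i < n, wd (rv n (Yb n w n)) i = w i := by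
  intro i hi
  have hF := rv_full hw
  have key : ∀ r ≤ n, (r ≤ wd (rv n (Yb n w n)) i ↔ r ≤ w i) := by
    intro r hr
    rw [← act_iff hF.toPP (hF.full i hi)]
    have hl := lev_rv hw r hr i hi
    have h := Yb_good hw (n - r) (by omega)
    have e : n - (n - r) = r := by omega
    rw [e] at h
    have ha := h.act (n - 1 - i) (by omega)
    have e2 : n - 1 - (n - 1 - i) = i := by omega
    rw [e2] at ha
    rw [← ha]
    constructor
    · rintro ⟨j, hj⟩
      have hjn := lev_supp hF.toPP n hF.supp r _ _ ((lev_PP hF.toPP r).hs _ _ hj)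
      exact ⟨_, (hl j hjn).1 hj⟩
    · rintro ⟨j, hj⟩
      have hjn := h.supp _ _ (h.hs _ _ hj)
      refine ⟨n - 1 - j, (hl _ (by omega)).2 ?_⟩
      have : n - 1 - (n - 1 - j) = j := by omega
      rwa [this]
  have h1 := hw.le i
  have h2 := wd_le (X := rv n (Yb n w n)) i
  have h3 := key (w i) (by omega)
  have h4 := key (wd (rv n (Yb n w n)) i) (by omega)
  omega

/-! transposition -/

def tr (w : ℕ → ℕ) (i : ℕ) : ℕ := cnt w (w i) i

theorem tr_congr {w w' : ℕ → ℕ} {n : ℕ} (h : ∀ i < n, w i = w' i) : ∀ i < n, tr w i = tr w' i := by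
  intro i hi
  unfold tr
  rw [h i hi]
  exact cnt_congr _ h i hi.le

theorem lat_anti {n : ℕ} {w : ℕ → ℕ} (hw : Lat n w) {i r s : ℕ} (hi : i ≤ n) (h : r ≤ s) :
    cnt w s i ≤ cnt w r i := by
  induction s, h using Nat.le_induction with
  | base => exact le_rfl
  | succ s _ ih => exact (hw.lat s i hi).trans ih

theorem cnt_tr {n : ℕ} {w : ℕ → ℕ} (hw : Lat n w) (c : ℕ) : ∀ i ≤ n,
    cnt (tr w) c i = ((Finset.range n).filter (fun r => c < cnt w r i)).card := by
  intro i
  induction i with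
  | zero => intro _; simp [cnt_zero]
  | succ i ih =>
    intro hi
    rw [cnt_succ, ih (by omega)]
    have hwi := hw.le i
    split_ifs with hc
    · rw [← Finset.card_insert_of_notMem (a := w i)]
      · congr 1
        ext r
        simp only [Finset.mem_insert, Finset.mem_filter, Finset.mem_range, cnt_succ]
        unfold tr at hc
        by_cases hr : w i = r
        · subst hr; simp; omega
        · simp [hr]; intro h; exact absurd h.symm hr
      · unfold tr at hc
        simp [hc]
    · rw [add_zero]
      congr 1
      ext r
      simp only [Finset.mem_filter, Finset.mem_range, cnt_succ]
      unfold tr at hc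
      by_cases hr : w i = r
      · subst hr; simp; omega
      · simp [hr]

theorem cnt_le (w : ℕ → ℕ) (r i : ℕ) : cnt w r i ≤ i := by
  unfold cnt
  exact (Finset.card_filter_le _ _).trans (by simp)

theorem lat_tr {n : ℕ} {w : ℕ → ℕ} (hw : Lat n w) : Lat n (tr w) where
  le := fun i => cnt_le _ _ _
  lat := by
    intro c i hi
    rw [cnt_tr hw _ _ hi, cnt_tr hw _ _ hi]
    apply Finset.card_le_card
    intro r
    simp only [Finset.mem_filter, Finset.mem_range]
    omega

theorem cnt_other {w : ℕ → ℕ} {i r : ℕ} (h : w i ≠ r) : cnt w r (i + 1) = cnt w r i := by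
  rw [cnt_succ, if_neg h]; rfl

theorem cnt_self {w : ℕ → ℕ} {i : ℕ} : cnt w (w i) (i + 1) = tr w i + 1 := by
  rw [cnt_succ, if_pos rfl]; rfl

theorem tr_tr {n : ℕ} {w : ℕ → ℕ} (hw : Lat n w) : ∀ i < n, tr (tr w) i = w i := by
  intro i hi
  have hwi := hw.le i
  have : tr (tr w) i = cnt (tr w) (tr w i) i := rfl
  rw [this, cnt_tr hw _ _ hi.le]
  rw [← Finset.card_range (w i)]
  congr 1
  ext r
  simp only [Finset.mem_filter, Finset.mem_range]
  constructor
  · rintro ⟨_, h⟩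
    by_contra hr
    have := lat_anti hw hi.le (Nat.le_of_not_lt hr)
    unfold tr at h
    omega
  · intro hr
    refine ⟨by omega, ?_⟩
    have h1 := lat_anti hw (i := i + 1) hi hr.le
    rw [cnt_self, cnt_other (by omega)] at h1
    omega

theorem tr_desc {n : ℕ} {w : ℕ → ℕ} (hw : Lat n w) {i : ℕ} (hi : i + 1 < n) :
    w i < w (i + 1) ↔ tr w (i + 1) ≤ tr w i := by
  constructor
  · intro h
    have h1 := lat_anti hw (i := i + 2) hi h.le
    rw [cnt_self, cnt_other (by omega), cnt_self] at h1
    omega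
  · intro h
    by_contra hcon
    have h1 := lat_anti hw (i := i + 1) hi.le (Nat.le_of_not_lt hcon)
    rw [cnt_self] at h1
    have : tr w (i + 1) = cnt w (w (i + 1)) (i + 1) := rfl
    omega

theorem tr_long {n : ℕ} {w : ℕ → ℕ} (hw : Lat n w) (k : ℕ) :
    k + 1 ≤ cnt w 0 n ↔ ∃ i < n, k ≤ tr w i := by
  constructor
  · intro h
    by_contra hcon
    push Not at hcon
    have : ∀ i ≤ n, cnt w 0 i ≤ k := by
      intro i
      induction i with
      | zero => intro _; rw [cnt_zero]; omega
      | succ i ih =>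
        intro hi
        have h1 := ih (by omega)
        have h2 := hcon i (by omega)
        rw [cnt_succ]
        unfold tr at h2
        split_ifs with h3
        · rw [h3] at h2; omega
        · omega
    have := this n le_rfl
    omega
  · rintro ⟨i, hi, h⟩
    have h1 := lat_anti hw (i := i + 1) hi (Nat.zero_le (w i))
    rw [cnt_self] at h1
    have h2 := cnt_mono w 0 (i := i + 1) (j := n) hi
    omega

/-! permutations -/

def M {n : ℕ} (π : Equiv.Perm (Fin n)) (i j : ℕ) : Prop :=
  ∃ (hi : i < n) (hj : j < n), π ⟨i, hi⟩ = ⟨j, hj⟩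

theorem M_apply {n : ℕ} (π : Equiv.Perm (Fin n)) (i : Fin n) : M π i (π i) :=
  ⟨i.2, (π i).2, rfl⟩

theorem M_full {n : ℕ} {π : Equiv.Perm (Fin n)} (h : IsInvolution π) : Full n (M π) := by
  refine ⟨⟨fun _ => Or.inl rfl, ?_, ?_, ?_⟩, ?_, ?_⟩
  · rintro i j ⟨h1, h2, h3⟩
    exact ⟨h2, h1, by rw [← h3, h]⟩
  · rintro i j k ⟨h1, h2, h3⟩ ⟨h4, h5, h6⟩
    rw [h3] at h6
    simpa using h6
  · intro i j h1; simp [Z] at h1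
  · intro i j hx; exact hx.1
  · intro i hi
    exact ⟨_, M_apply π ⟨i, hi⟩⟩

theorem exists_perm {n : ℕ} {X : ℕ → ℕ → Prop} (h : Full n X) :
    ∃ π : Equiv.Perm (Fin n), IsInvolution π ∧ M π = X := by
  have h1 : ∀ i : Fin n, ∃ j : Fin n, X i j := by
    intro i
    obtain ⟨j, hj⟩ := h.full i i.2
    exact ⟨⟨j, h.supp _ _ (h.hs _ _ hj)⟩, hj⟩
  choose f hf using h1
  have hff : ∀ i, f (f i) = i := by
    intro i
    exact Fin.ext (h.hc _ _ _ (hf (f i)) (h.hs _ _ (hf i)))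
  refine ⟨⟨f, f, hff, hff⟩, hff, ?_⟩
  funext i j
  apply propext
  constructor
  · rintro ⟨hi, hj, e⟩
    have := hf ⟨i, hi⟩
    have e' : f ⟨i, hi⟩ = ⟨j, hj⟩ := e
    rw [e'] at this
    exact this
  · intro hx
    have hi := h.supp _ _ hx
    have hj := h.supp _ _ (h.hs _ _ hx)
    exact ⟨hi, hj, Fin.ext (h.hc _ _ _ (hf ⟨i, hi⟩) hx)⟩

noncomputable abbrev W {n : ℕ} (π : Equiv.Perm (Fin n)) : ℕ → ℕ := wd (M π)

theorem W_inj {n : ℕ} {π σ : Equiv.Perm (Fin n)} (hπ : IsInvolution π) (hσ : IsInvolution σ)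
    (h : ∀ i < n, W π i = W σ i) : π = σ := by
  ext i
  obtain ⟨_, _, h3⟩ := (wd_inj (M_full hπ) (M_full hσ) h i i.2 (π i) (π i).2).1 (M_apply π i)
  exact (congrArg Fin.val h3).symm

theorem W_lat {n : ℕ} {π : Equiv.Perm (Fin n)} (hπ : IsInvolution π) : Lat n (W π) :=
  lat_wd (M_full hπ)

theorem exists_tr {n : ℕ} (π : Equiv.Perm (Fin n)) (hπ : IsInvolution π) :
    ∃ σ : Equiv.Perm (Fin n), IsInvolution σ ∧ ∀ i < n, W σ i = tr (W π) i := by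
  have hl := lat_tr (W_lat hπ)
  obtain ⟨σ, h1, h2⟩ := exists_perm (rv_full hl)
  refine ⟨σ, h1, ?_⟩
  unfold W
  rw [h2]
  exact wd_rv hl

theorem W_desc {n : ℕ} {π : Equiv.Perm (Fin n)} (hπ : IsInvolution π) (i : Fin n)
    (h : (i : ℕ) + 1 < n) : π ⟨(i : ℕ) + 1, h⟩ < π i ↔ W π i < W π (i + 1) := by
  have h1 := M_apply π i
  have h2 := M_apply π ⟨(i : ℕ) + 1, h⟩
  constructor
  · intro hlt
    exact wd_desc (M_full hπ) h1 h2 hlt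
  · intro hW
    by_contra hcon
    have hne : π i ≠ π ⟨(i : ℕ) + 1, h⟩ := by
      intro e
      have := congrArg Fin.val (π.injective e)
      simp at this
    have hlt : π i < π ⟨(i : ℕ) + 1, h⟩ := lt_of_le_of_ne (not_lt.1 hcon) hne
    have := wd_asc (M_full hπ) h1 h2 hlt
    unfold W at hW
    omega

theorem contains_inc {n : ℕ} (π : Equiv.Perm (Fin n)) :
    Contains π p1234 ↔ Inc (M π) 4 n n := by
  constructor
  · rintro ⟨f, hf, h⟩
    have l : ∀ a b : Fin 4, a < b → (π (f a) : ℕ) < π (f b) := by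
      intro a b hab
      refine (h a b).2 ?_
      revert a b; decide
    exact ⟨f 3, π (f 3), (f 3).2, (π (f 3)).2, M_apply π _,
      f 2, π (f 2), hf (by decide), l _ _ (by decide), M_apply π _,
      f 1, π (f 1), hf (by decide), l _ _ (by decide), M_apply π _,
      f 0, π (f 0), hf (by decide), l _ _ (by decide), M_apply π _, trivial⟩
  · rintro ⟨x3, y3, a3, b3, ⟨u3, v3, m3⟩, x2, y2, a2, b2, ⟨u2, v2, m2⟩,
      x1, y1, a1, b1, ⟨u1, v1, m1⟩, x0, y0, a0, b0, ⟨u0, v0, m0⟩, -⟩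
    refine ⟨![⟨x0, u0⟩, ⟨x1, u1⟩, ⟨x2, u2⟩, ⟨x3, u3⟩], ?_, ?_⟩
    · intro a b hab
      fin_cases a <;> fin_cases b <;> simp at hab ⊢ <;> omega
    · intro a b
      have hp : p1234 a < p1234 b ↔ a < b := by revert a b; decide
      rw [hp]
      fin_cases a <;> fin_cases b <;> simp [m0, m1, m2, m3] <;> omega

theorem contains_dec {n : ℕ} (π : Equiv.Perm (Fin n)) :
    Contains π p4321 ↔ Dec (M π) 4 0 n := by
  constructor
  · rintro ⟨f, hf, h⟩
    have l : ∀ a b : Fin 4, b < a → (π (f a) : ℕ) < π (f b) := by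
      intro a b hab
      refine (h a b).2 ?_
      revert a b; decide
    have s : ∀ a b : Fin 4, a < b → (f a : ℕ) + 1 ≤ f b := fun a b hab => hf hab
    exact ⟨f 0, π (f 0), Nat.zero_le _, (π (f 0)).2, M_apply π _,
      f 1, π (f 1), s _ _ (by decide), l _ _ (by decide), M_apply π _,
      f 2, π (f 2), s _ _ (by decide), l _ _ (by decide), M_apply π _,
      f 3, π (f 3), s _ _ (by decide), l _ _ (by decide), M_apply π _, trivial⟩
  · rintro ⟨x0, y0, a0, b0, ⟨u0, v0, m0⟩, x1, y1, a1, b1, ⟨u1, v1, m1⟩,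
      x2, y2, a2, b2, ⟨u2, v2, m2⟩, x3, y3, a3, b3, ⟨u3, v3, m3⟩, -⟩
    refine ⟨![⟨x0, u0⟩, ⟨x1, u1⟩, ⟨x2, u2⟩, ⟨x3, u3⟩], ?_, ?_⟩
    · intro a b hab
      fin_cases a <;> fin_cases b <;> simp at hab ⊢ <;> omega
    · intro a b
      have hp : p4321 a < p4321 b ↔ b < a := by revert a b; decide
      rw [hp]
      fin_cases a <;> fin_cases b <;> simp [m0, m1, m2, m3] <;> omega

theorem W_inc {n : ℕ} {π : Equiv.Perm (Fin n)} (hπ : IsInvolution π) :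
    Contains π p1234 ↔ 4 ≤ cnt (W π) 0 n := by
  have hF := M_full hπ
  rw [contains_inc, ← cnt_wd hF 0 n le_rfl]
  exact ⟨inc_le hF.toPP _ _ _, inc_of_le hF.toPP _ _ _ _ rfl⟩

theorem W_dec {n : ℕ} {π : Equiv.Perm (Fin n)} (hπ : IsInvolution π) :
    Contains π p4321 ↔ ∃ i < n, 3 ≤ W π i := by
  have hF := M_full hπ
  have hs := lev_supp hF.toPP n hF.supp
  have hP := lev_PP hF.toPP
  rw [contains_dec]
  have e1 : Dec (M π) 4 0 n ↔ Dec (lev (M π) 1) 3 0 n := Dec_nx (hP 0) n 2 (hs 0)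
  have e2 : Dec (lev (M π) 1) 3 0 n ↔ Dec (lev (M π) 2) 2 0 n := Dec_nx (hP 1) n 1 (hs 1)
  have e3 : Dec (lev (M π) 2) 2 0 n ↔ Dec (lev (M π) 3) 1 0 n := Dec_nx (hP 2) n 0 (hs 2)
  rw [e1, e2, e3]
  constructor
  · rintro ⟨x, y, _, _, h, -⟩
    have hx := hs 3 _ _ h
    exact ⟨x, hx, (act_iff hF.toPP (hF.full x hx) 3).1 ⟨y, h⟩⟩
  · rintro ⟨x, hx, h⟩
    obtain ⟨y, hy⟩ := (act_iff hF.toPP (hF.full x hx) 3).2 h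
    exact ⟨x, y, Nat.zero_le _, hs 3 _ _ ((hP 3).hs _ _ hy), hy, trivial⟩

theorem alt_iff {n : ℕ} {π : Equiv.Perm (Fin n)} (hπ : IsInvolution π) :
    IsAlternating π ↔ ∀ i, i + 1 < n → (¬ W π i < W π (i + 1) ↔ Odd (i + 1)) := by
  have key : ∀ (i : Fin n) (h : (i : ℕ) + 1 < n),
      (π i < π ⟨(i : ℕ) + 1, h⟩ ↔ ¬ W π i < W π (i + 1)) := by
    intro i h
    rw [← W_desc hπ i h, not_lt]
    have hne : π i ≠ π ⟨(i : ℕ) + 1, h⟩ := by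
      intro e
      have := congrArg Fin.val (π.injective e)
      simp at this
    exact ⟨le_of_lt, fun h => lt_of_le_of_ne h hne⟩
  constructor
  · intro h i hi
    rw [← key ⟨i, by omega⟩ hi]
    exact h ⟨i, by omega⟩ hi
  · intro h i hi
    rw [key i hi]
    exact h i hi

theorem ralt_iff {n : ℕ} {π : Equiv.Perm (Fin n)} (hπ : IsInvolution π) :
    IsRevAlternating π ↔ ∀ i, i + 1 < n → (W π i < W π (i + 1) ↔ Odd (i + 1)) := by
  constructor
  · intro h i hi
    have := h ⟨i, by omega⟩ hi
    rwa [W_desc hπ ⟨i, by omega⟩ hi] at this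
  · intro h i hi
    rw [W_desc hπ i hi]
    exact h i hi

theorem tr_rel {n : ℕ} {π σ : Equiv.Perm (Fin n)} (hπ : IsInvolution π) (hσ : IsInvolution σ)
    (h : ∀ i < n, W σ i = tr (W π) i) :
    (IsAlternating π ∧ Avoids π p1234) ↔ (IsRevAlternating σ ∧ Avoids σ p4321) := by
  have hl := W_lat hπ
  rw [alt_iff hπ, ralt_iff hσ]
  unfold Avoids
  rw [W_inc hπ, W_dec hσ, tr_long hl 3]
  apply and_congr
  · refine forall_congr' fun i => forall_congr' fun hi => ?_
    rw [tr_desc hl hi, h i (by omega), h (i + 1) hi, not_le]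
  · apply not_congr
    constructor
    · rintro ⟨i, hi, h1⟩; exact ⟨i, hi, by rw [h i hi]; exact h1⟩
    · rintro ⟨i, hi, h1⟩; exact ⟨i, hi, by rw [← h i hi]; exact h1⟩

theorem tr_rel_symm {n : ℕ} {π σ : Equiv.Perm (Fin n)} (hπ : IsInvolution π)
    (h : ∀ i < n, W σ i = tr (W π) i) : ∀ i < n, W π i = tr (W σ) i := by
  intro i hi
  rw [tr_congr h i hi, tr_tr (W_lat hπ) i hi]

end RSG

theorem card_AI_1234_eq_card_RAI_4321 (n : ℕ) :
    Nat.card {π : Equiv.Perm (Fin n) //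
      IsInvolution π ∧ IsAlternating π ∧ Avoids π p1234} =
    Nat.card {π : Equiv.Perm (Fin n) //
      IsInvolution π ∧ IsRevAlternating π ∧ Avoids π p4321} := by
  choose f hf1 hf2 using @RSG.exists_tr n
  have hinv : ∀ π (hπ : IsInvolution π), f (f π hπ) (hf1 π hπ) = π := by
    intro π hπ
    apply RSG.W_inj (hf1 _ _) hπ
    intro i hi
    rw [hf2 _ _ i hi]
    exact (RSG.tr_rel_symm hπ (hf2 π hπ) i hi).symm
  refine Nat.card_congr
    ⟨fun π => ⟨f π.1 π.2.1, hf1 _ _, (RSG.tr_rel π.2.1 (hf1 _ _) (hf2 _ _)).1 π.2.2⟩,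
     fun σ => ⟨f σ.1 σ.2.1, hf1 _ _,
      (RSG.tr_rel (hf1 _ _) σ.2.1 (RSG.tr_rel_symm σ.2.1 (hf2 _ _))).2 σ.2.2⟩,
     fun π => Subtype.ext (hinv _ _), fun σ => Subtype.ext (hinv _ _)⟩
end
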